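/- arXiv:1401.2333 — 4 statements merged into one kernel-verified Lean document; each statement's English description precedes it below -/
import Mathlib

section
/- The translation T is conjugate to its inverse within the group of orientation preserving homeomorphisms preserving both orbits: there exists an orientation preserving homeomorphism Ψ₀ of ℝ² with Ψ₀(ℤ₁) = ℤ₁ and Ψ₀(ℤ₂) = ℤ₂ such that Ψ₀∘T∘Ψ₀⁻¹ = T⁻¹. -/
open Set

/-- The plane. -/
abbrev Plane : Type := ℝ × ℝ

/-- `f` is (the underlying function of) a homeomorphism of the plane. -/
def IsHomeoFun (f : Plane → Plane) : Prop :=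
  ∃ e : Plane ≃ₜ Plane, ∀ x, e x = f x

/-- `g` and `g'` are isotopic relative to `O` : there is a continuous family
`F (t, ·)`, `t ∈ [0,1]`, of homeomorphisms of the plane going from `g` to `g'`
and agreeing with `g` on `O` for all times. -/
def IsotopicRel (g g' : Plane → Plane) (O : Set Plane) : Prop :=
  ∃ F : ℝ × Plane → Plane, Continuous F ∧
    (∀ t ∈ Icc (0:ℝ) 1, IsHomeoFun fun x => F (t, x)) ∧
    (∀ x, F (0, x) = g x) ∧
    (∀ x, F (1, x) = g' x) ∧
    (∀ t ∈ Icc (0:ℝ) 1, ∀ x ∈ O, F (t, x) = g x)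

/-- A homeomorphism of the plane is orientation preserving iff it is isotopic
to the identity. -/
def OrientationPreserving (h : Plane ≃ₜ Plane) : Prop :=
  IsotopicRel id (⇑h) (∅ : Set Plane)

/-- A Brouwer homeomorphism: orientation preserving and fixed point free. -/
def IsBrouwer (h : Plane ≃ₜ Plane) : Prop :=
  OrientationPreserving h ∧ ∀ x, h x ≠ x

/-- The orbit of a point under a homeomorphism. -/
def horbit (h : Plane ≃ₜ Plane) (x : Plane) : Set Plane :=
  {y | ∃ n : ℤ, y = (h.toEquiv ^ n) x}

/-- `ℤ₁ = ℤ × {1}`. -/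
def Z1 : Set Plane := {p | ∃ n : ℤ, p = ((n : ℝ), 1)}

/-- `ℤ₂ = ℤ × {2}`. -/
def Z2 : Set Plane := {p | ∃ n : ℤ, p = ((n : ℝ), 2)}

/-- The shear homeomorphism `(x, y) ↦ (x + f y, y)`. -/
def shear (f : ℝ → ℝ) (hf : Continuous f) : Plane ≃ₜ Plane where
  toFun p := (p.1 + f p.2, p.2)
  invFun p := (p.1 - f p.2, p.2)
  left_inv p := by simp
  right_inv p := by simp
  continuous_toFun := (continuous_fst.add (hf.comp continuous_snd)).prodMk continuous_snd
  continuous_invFun := (continuous_fst.sub (hf.comp continuous_snd)).prodMk continuous_snd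

/-- The translation `T (x, y) = (x + 1, y)`. -/
def T : Plane ≃ₜ Plane := shear (fun _ => 1) continuous_const

/-- The twist `T₁ (x, y) = (x + 2 - y, y)`. -/
def T₁ : Plane ≃ₜ Plane := shear (fun y => 2 - y) (by continuity)

/-- The twist `T₂ (x, y) = (x + y - 1, y)`. -/
def T₂ : Plane ≃ₜ Plane := shear (fun y => y - 1) (by continuity)

/-- The model Reeb homeomorphism `R₀ = T₁ ∘ T₂⁻¹`, `R₀ (x, y) = (x + 3 - 2y, y)`. -/
def R₀ : Plane ≃ₜ Plane := shear (fun y => 3 - 2 * y) (by continuity)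

/-- The Euclidean norm on the plane. -/
noncomputable def planeNorm (p : Plane) : ℝ := Real.sqrt (p.1 ^ 2 + p.2 ^ 2)

/-- An angle function for a fixed point free map `h'` along a curve `γ`. -/
def IsAngleFunction (h' : Plane → Plane) (γ : ℝ → Plane) (θ : ℝ → ℝ) : Prop :=
  ContinuousOn θ (Icc 0 1) ∧
    ∀ t ∈ Icc (0:ℝ) 1,
      h' (γ t) - γ t =
        planeNorm (h' (γ t) - γ t) • (Real.cos (θ t), Real.sin (θ t))

/-- The conjugate `Φ ∘ h ∘ Φ⁻¹`. -/
def conjH (Φ h : Plane ≃ₜ Plane) : Plane ≃ₜ Plane := Φ.symm.trans (h.trans Φ)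

/-- An admissible straightening `Φ` for `(h, O₁, O₂)` : an orientation preserving
homeomorphism sending `O₁, O₂` to `ℤ₁, ℤ₂` such that `Φ ∘ h ∘ Φ⁻¹` is isotopic
relative to `ℤ₁ ∪ ℤ₂` to a homeomorphism translating each line `ℝ × {i}` by `±1`. -/
def AdmissibleStraightening (h : Plane ≃ₜ Plane) (O₁ O₂ : Set Plane)
    (Φ : Plane ≃ₜ Plane) : Prop :=
  OrientationPreserving Φ ∧ Φ '' O₁ = Z1 ∧ Φ '' O₂ = Z2 ∧
    ∃ ε₁ ε₂ : ℝ, (ε₁ = 1 ∨ ε₁ = -1) ∧ (ε₂ = 1 ∨ ε₂ = -1) ∧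
      ∃ g : Plane ≃ₜ Plane,
        (∀ x : ℝ, g (x, 1) = (x + ε₁, 1)) ∧
        (∀ x : ℝ, g (x, 2) = (x + ε₂, 2)) ∧
        IsotopicRel (⇑(conjH Φ h)) (⇑g) (Z1 ∪ Z2)

/-- A flow on the plane. -/
def IsFlow (φ : ℝ → Plane → Plane) : Prop :=
  Continuous (fun p : ℝ × Plane => φ p.1 p.2) ∧
    (∀ x, φ 0 x = x) ∧ ∀ s t x, φ (s + t) x = φ s (φ t x)

/-- A topological line in the plane: the image of a proper injective continuous
map from `ℝ` to the plane. -/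
def IsTopLine (L : Set Plane) : Prop :=
  ∃ f : ℝ → Plane, Continuous f ∧ Function.Injective f ∧ IsProperMap f ∧ range f = L

/-- The rotation of the plane by the angle `θ`. -/
noncomputable def planeRotation (θ : ℝ) : Plane ≃ₜ Plane where
  toFun p := (Real.cos θ * p.1 - Real.sin θ * p.2, Real.sin θ * p.1 + Real.cos θ * p.2)
  invFun p := (Real.cos θ * p.1 + Real.sin θ * p.2, Real.cos θ * p.2 - Real.sin θ * p.1)
  left_inv p := by
    have h := Real.sin_sq_add_cos_sq θ
    ext
    · linear_combination p.1 * h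
    · linear_combination p.2 * h
  right_inv p := by
    have h := Real.sin_sq_add_cos_sq θ
    ext
    · linear_combination p.1 * h
    · linear_combination p.2 * h
  continuous_toFun := by fun_prop
  continuous_invFun := by fun_prop

/-- The vertical shear `(x, y) ↦ (x, y + g x)`. -/
def verticalShear (g : ℝ → ℝ) (hg : Continuous g) : Plane ≃ₜ Plane where
  toFun p := (p.1, p.2 + g p.1)
  invFun p := (p.1, p.2 - g p.1)
  left_inv p := by simp
  right_inv p := by simp
  continuous_toFun := by fun_prop
  continuous_invFun := by fun_prop

/-- A homeomorphism commuting with `T` which sends `(0, 0)` to `(0, 1)` and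
`(1 / 2, 0)` to `(0, 2)`. -/
noncomputable def straighten : Plane ≃ₜ Plane :=
  (verticalShear (fun x => (3 - Real.cos (2 * Real.pi * x)) / 2) (by fun_prop)).trans
    (shear (fun y => (1 - y) / 2) (by fun_prop))

/-- A conjugate of a rotation is orientation preserving. -/
theorem orientationPreserving_conjH_planeRotation (Φ : Plane ≃ₜ Plane) (θ : ℝ) :
    OrientationPreserving (conjH Φ (planeRotation θ)) := by
  refine ⟨fun q => conjH Φ (planeRotation (q.1 * θ)) q.2, ?_, fun t _ =>
    ⟨conjH Φ (planeRotation (t * θ)), fun _ => rfl⟩,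
    fun x => ?_, fun x => by simp, by simp⟩
  · refine Φ.continuous.comp (f := fun q : ℝ × Plane =>
      ((Real.cos (q.1 * θ) * (Φ.symm q.2).1 - Real.sin (q.1 * θ) * (Φ.symm q.2).2,
        Real.sin (q.1 * θ) * (Φ.symm q.2).1 + Real.cos (q.1 * θ) * (Φ.symm q.2).2) : Plane)) ?_
    fun_prop
  · simp [conjH, planeRotation]

/-- The conjugate by `straighten` of the half turn, in coordinates. -/
theorem conjH_straighten_planeRotation_pi (x y : ℝ) :
    conjH straighten (planeRotation Real.pi) (x, y) =
      (-x - 1 / 2 + Real.cos (2 * Real.pi * (x + (y - 1) / 2)) / 2,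
        3 - Real.cos (2 * Real.pi * (x + (y - 1) / 2)) - y) := by
  have hs : straighten.symm (x, y) = (x - (1 - y) / 2,
      y - (3 - Real.cos (2 * Real.pi * (x - (1 - y) / 2))) / 2) := rfl
  have hx : x - (1 - y) / 2 = x + (y - 1) / 2 := by ring
  rw [hx] at hs
  have hr (a b : ℝ) : planeRotation Real.pi (a, b) = (-a, -b) := by
    simp [planeRotation]
  have hk (a b : ℝ) : straighten (a, b) =
      (a + (1 - (b + (3 - Real.cos (2 * Real.pi * a)) / 2)) / 2,
        b + (3 - Real.cos (2 * Real.pi * a)) / 2) := rfl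
  simp only [conjH, Homeomorph.trans_apply, hs, hr, hk, mul_neg, Real.cos_neg]
  ext <;> ring

/-- The half turn about `straighten (0, 0)` maps `(n, 1)` to `(-n, 1)`. -/
theorem conjH_straighten_planeRotation_pi_one (n : ℤ) :
    conjH straighten (planeRotation Real.pi) ((n : ℝ), 1) = (((-n : ℤ) : ℝ), 1) := by
  have h : Real.cos (2 * Real.pi * (n + (1 - 1) / 2)) = 1 := by
    rw [← Real.cos_int_mul_two_pi n]
    ring_nf
  rw [conjH_straighten_planeRotation_pi, h]
  ext <;> push_cast <;> ring

/-- The half turn about `straighten (0, 0)` maps `(n, 2)` to `(-n - 1, 2)`. -/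
theorem conjH_straighten_planeRotation_pi_two (n : ℤ) :
    conjH straighten (planeRotation Real.pi) ((n : ℝ), 2) = (((-n - 1 : ℤ) : ℝ), 2) := by
  have h : Real.cos (2 * Real.pi * (n + (2 - 1) / 2)) = -1 := by
    rw [← Real.cos_int_mul_two_pi_add_pi n]
    ring_nf
  rw [conjH_straighten_planeRotation_pi, h]
  ext <;> push_cast <;> ring

/-- The translation `T` is conjugate to its inverse within the
group of orientation preserving homeomorphisms preserving both `ℤ₁` and `ℤ₂`. -/
theorem translation_conjugate_to_inverse :
    ∃ Ψ₀ : Plane ≃ₜ Plane, OrientationPreserving Ψ₀ ∧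
      Ψ₀ '' Z1 = Z1 ∧ Ψ₀ '' Z2 = Z2 ∧
      ∀ p, Ψ₀ (T (Ψ₀.symm p)) = T.symm p := by
  refine ⟨conjH straighten (planeRotation Real.pi),
    orientationPreserving_conjH_planeRotation _ _, ?_, ?_, fun p => ?_⟩
  · apply Subset.antisymm
    · rintro _ ⟨_, ⟨n, rfl⟩, rfl⟩
      exact ⟨-n, conjH_straighten_planeRotation_pi_one n⟩
    · rintro _ ⟨n, rfl⟩
      refine ⟨_, ⟨-n, rfl⟩, ?_⟩
      rw [conjH_straighten_planeRotation_pi_one, neg_neg]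
  · apply Subset.antisymm
    · rintro _ ⟨_, ⟨n, rfl⟩, rfl⟩
      exact ⟨-n - 1, conjH_straighten_planeRotation_pi_two n⟩
    · rintro _ ⟨n, rfl⟩
      refine ⟨_, ⟨-n - 1, rfl⟩, ?_⟩
      rw [conjH_straighten_planeRotation_pi_two]
      ring_nf
  · obtain ⟨⟨x, y⟩, rfl⟩ := (conjH straighten (planeRotation Real.pi)).surjective p
    have hT : T (x, y) = (x + 1, y) := rfl
    have hT' (q : Plane) : T.symm q = (q.1 - 1, q.2) := rfl
    have h : Real.cos (2 * Real.pi * (x + 1 + (y - 1) / 2)) =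
        Real.cos (2 * Real.pi * (x + (y - 1) / 2)) := by
      rw [← Real.cos_add_two_pi (2 * Real.pi * (x + (y - 1) / 2))]
      ring_nf
    rw [Homeomorph.symm_apply_apply, hT, hT', conjH_straighten_planeRotation_pi,
      conjH_straighten_planeRotation_pi, h]
    ext <;> ring
end

section
/- Independence of the index on the curve: let h be a Brouwer homeomorphism of the plane with h(ℤ₁) = ℤ₁ and h(ℤ₂) = ℤ₂, and suppose h is isotopic relative to ℤ₁ ∪ ℤ₂ to a homeomorphism g of ℝ² satisfying g(x,1) = (x+ε₁, 1) and g(x,2) = (x+ε₂, 2) for all x ∈ ℝ and some ε₁, ε₂ ∈ {1, −1}. Then for any two continuous curves γ, γ′ : [0,1] → ℝ² with γ(0), γ′(0) ∈ ℤ₁ and γ(1), γ′(1) ∈ ℤ₂, and any angle functions θ for h along γ and θ′ for h along γ′, one has θ(1) − θ(0) = θ′(1) − θ′(0). -/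
open Set

/-- `θ` is a continuous determination on `S` of the argument of `f`. -/
def IsAngleOn {X : Type*} [TopologicalSpace X] (S : Set X) (f : X → ℂ) (θ : X → ℝ) : Prop :=
  ContinuousOn θ S ∧ ∀ x ∈ S, f x = ‖f x‖ * Complex.exp (θ x * Complex.I)

namespace IsAngleOn

variable {X Y : Type*} [TopologicalSpace X] [TopologicalSpace Y]

theorem exists_of_convex {E : Type*} [NormedAddCommGroup E] [NormedSpace ℝ E] {S : Set E}
    (hS : Convex ℝ S) (hSo : IsOpen S) {f : E → ℂ} (hf : ContinuousOn f S)
    (hf0 : ∀ x ∈ S, f x ≠ 0) : ∃ θ : E → ℝ, IsAngleOn S f θ := by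
  rcases S.eq_empty_or_nonempty with rfl | hne
  · exact ⟨0, continuousOn_empty _, fun x hx => absurd hx (notMem_empty x)⟩
  have hsc : IsSimplyConnected S := by
    have := hS.contractibleSpace hne
    exact (inferInstance : SimplyConnectedSpace S)
  obtain ⟨l, hl, hlf⟩ := Complex.exists_continuousOn_eqOn_exp_comp hsc hSo hf
    (by rintro ⟨x, hx, h0⟩; exact hf0 x hx h0)
  refine ⟨fun x => (l x).im, Complex.continuous_im.comp_continuousOn hl, fun x hx => ?_⟩
  have h := hlf hx
  simp only [Function.comp_apply] at h
  rw [← h, Complex.norm_exp, Complex.ofReal_exp, ← Complex.exp_add, Complex.re_add_im]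

theorem comp {S : Set X} {T : Set Y} {f : X → ℂ} {θ : X → ℝ} (hθ : IsAngleOn S f θ) {φ : Y → X}
    (hφ : ContinuousOn φ T) (hm : MapsTo φ T S) :
    IsAngleOn T (fun y => f (φ y)) (fun y => θ (φ y)) :=
  ⟨hθ.1.comp hφ hm, fun _ hy => hθ.2 _ (hm hy)⟩

theorem congr {S : Set X} {f f' : X → ℂ} {θ : X → ℝ} (hθ : IsAngleOn S f θ)
    (h : ∀ x ∈ S, f' x = f x) : IsAngleOn S f' θ :=
  ⟨hθ.1, fun x hx => by rw [h x hx]; exact hθ.2 x hx⟩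

/-- Two determinations of the argument, of functions whose directions differ by a constant
rotation, differ by a constant. -/
theorem exists_int {S : Set X} (hS : IsPreconnected S) {f₁ f₂ : X → ℂ} {θ₁ θ₂ : X → ℝ}
    (h₁ : IsAngleOn S f₁ θ₁) (h₂ : IsAngleOn S f₂ θ₂) (h0 : ∀ x ∈ S, f₁ x ≠ 0) (α : ℝ)
    (hf : ∀ x ∈ S, f₁ x = Complex.exp (α * Complex.I) * f₂ x) :
    ∃ j : ℤ, ∀ x ∈ S, θ₁ x = θ₂ x + α + 2 * Real.pi * j := by
  rcases S.eq_empty_or_nonempty with rfl | ⟨x₀, hx₀⟩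
  · exact ⟨0, fun x hx => absurd hx (notMem_empty x)⟩
  have hmem : ∀ x ∈ S, θ₁ x - θ₂ x - α ∈ AddSubgroup.zmultiples (2 * Real.pi) := by
    intro x hx
    have e₁ := h₁.2 x hx
    have e₂ := h₂.2 x hx
    have e := hf x hx
    have hn : ‖f₁ x‖ = ‖f₂ x‖ := by
      rw [e, norm_mul, Complex.norm_exp_ofReal_mul_I, one_mul]
    have hn0 : (‖f₁ x‖ : ℂ) ≠ 0 := by simpa using h0 x hx
    have key : Complex.exp (θ₁ x * Complex.I) =
        Complex.exp ((α : ℂ) * Complex.I + θ₂ x * Complex.I) := by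
      rw [Complex.exp_add]
      apply mul_left_cancel₀ hn0
      rw [← e₁, mul_left_comm, hn, ← e₂, e]
    obtain ⟨n, hn⟩ := Complex.exp_eq_exp_iff_exists_int.1 key
    refine ⟨n, ?_⟩
    have h3 : ((θ₁ x - θ₂ x - α : ℝ) : ℂ) * Complex.I = ((n * (2 * Real.pi) : ℝ) : ℂ) * Complex.I := by
      push_cast
      linear_combination hn
    have h4 := Complex.ofReal_injective (mul_right_cancel₀ Complex.I_ne_zero h3)
    simp only [zsmul_eq_mul]
    exact h4.symm
  have hc : ContinuousOn (fun x => θ₁ x - θ₂ x - α) S := (h₁.1.sub h₂.1).sub continuousOn_const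
  obtain ⟨j, hj⟩ := hmem x₀ hx₀
  refine ⟨j, fun x hx => ?_⟩
  have hd : IsDiscrete (AddSubgroup.zmultiples (2 * Real.pi) : Set ℝ) :=
    ⟨inferInstanceAs (DiscreteTopology (AddSubgroup.zmultiples (2 * Real.pi)))⟩
  have := hS.constant_of_mapsTo hd hc hmem hx hx₀
  simp only [zsmul_eq_mul] at hj this
  linarith

theorem exists_int_of_eq {S : Set X} (hS : IsPreconnected S) {f₁ f₂ : X → ℂ} {θ₁ θ₂ : X → ℝ}
    (h₁ : IsAngleOn S f₁ θ₁) (h₂ : IsAngleOn S f₂ θ₂) (h0 : ∀ x ∈ S, f₁ x ≠ 0)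
    (hf : ∀ x ∈ S, f₁ x = f₂ x) :
    ∃ j : ℤ, ∀ x ∈ S, θ₁ x = θ₂ x + 2 * Real.pi * j := by
  simpa using h₁.exists_int hS h₂ h0 0 (by simpa using hf)

theorem exists_int_of_eq_neg {S : Set X} (hS : IsPreconnected S) {f₁ f₂ : X → ℂ}
    {θ₁ θ₂ : X → ℝ} (h₁ : IsAngleOn S f₁ θ₁) (h₂ : IsAngleOn S f₂ θ₂) (h0 : ∀ x ∈ S, f₁ x ≠ 0)
    (hf : ∀ x ∈ S, f₁ x = -f₂ x) :
    ∃ j : ℤ, ∀ x ∈ S, θ₁ x = θ₂ x + (2 * j + 1) * Real.pi := by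
  obtain ⟨j, hj⟩ := h₁.exists_int hS h₂ h0 Real.pi (by simpa [Complex.exp_pi_mul_I] using hf)
  exact ⟨j, fun x hx => by rw [hj x hx]; ring⟩

/-- The argument does not vary between two points where the direction is the same, as long as it
stays in an open half plane centered at that direction. -/
theorem eq_of_re_pos {S : Set X} (hS : IsPreconnected S) {f g : X → ℂ} {θ : X → ℝ}
    (hθ : IsAngleOn S f θ) (hg : ContinuousOn g S) (hre : ∀ x ∈ S, 0 < (g x).re) {c : ℂ}
    (hc : ‖c‖ = 1) (hf : ∀ x ∈ S, f x = c * g x) {x y : X} (hx : x ∈ S) (hy : y ∈ S)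
    (hgx : (g x).im = 0) (hgy : (g y).im = 0) : θ x = θ y := by
  have ha : IsAngleOn S g fun x => (g x).arg := by
    refine ⟨fun z hz => ?_, fun z hz => (Complex.norm_mul_exp_arg_mul_I _).symm⟩
    exact (Complex.continuousAt_arg (Or.inl (hre z hz))).comp_continuousWithinAt (hg z hz)
  have hg0 : ∀ z ∈ S, g z ≠ 0 := fun z hz h => by simpa [h] using hre z hz
  have hc' : Complex.exp (c.arg * Complex.I) = c := by
    simpa [hc] using Complex.norm_mul_exp_arg_mul_I c
  have hc0 : c ≠ 0 := by rintro rfl; simp at hc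
  obtain ⟨j, hj⟩ := hθ.exists_int hS ha
    (fun z hz => by rw [hf z hz]; exact mul_ne_zero hc0 (hg0 z hz)) c.arg
    (fun z hz => by rw [hc', hf z hz])
  have arg0 : ∀ z ∈ S, (g z).im = 0 → (g z).arg = 0 := fun z hz h =>
    Complex.arg_eq_zero_iff.2 ⟨(hre z hz).le, h⟩
  rw [hj x hx, hj y hy, arg0 x hx hgx, arg0 y hy hgy]

end IsAngleOn

/-- Coincidences of an equivariant path can be translated. -/
theorem apply_add_int_eq_of_equivariant {X : Type*} [TopologicalSpace X] {h : X ≃ₜ X} {β : ℝ → X}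
    (hβh : ∀ u, β (u + 1) = h (β u)) {u v : ℝ} (huv : β u = β v) (n : ℤ) :
    β (u + n) = β (v + n) := by
  induction n using Int.induction_on with
  | zero => simpa using huv
  | succ n ih =>
    push_cast at ih ⊢
    rw [← add_assoc, ← add_assoc, hβh, hβh, ih]
  | pred n ih =>
    push_cast at ih ⊢
    apply h.injective
    rw [← hβh, ← hβh]
    convert ih using 2 <;> ring

theorem apply_fract_eq_of_equivariant {X : Type*} [TopologicalSpace X] {h : X ≃ₜ X} {β : ℝ → X}
    (hβh : ∀ u, β (u + 1) = h (β u)) {u v : ℝ} (huv : β u = β v) :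
    β (Int.fract u) = β (Int.fract u + (v - u)) := by
  have := apply_add_int_eq_of_equivariant hβh huv (-⌊u⌋)
  convert this using 2 <;> push_cast <;> simp only [Int.fract] <;> ring

/-- An equivariant parametrized path `β` of a fixed point free homeomorphism isotopic to the
identity is injective as soon as it is injective on intervals of length one. -/
theorem injective_of_locally_injective {h : ℂ ≃ₜ ℂ} {F : ℝ × ℂ → ℂ} (hF : Continuous F)
    (hFi : ∀ t, Function.Injective fun z => F (t, z)) (hF0 : ∀ z, F (0, z) = z)
    (hF1 : ∀ z, F (1, z) = h z) {Θ : ℂ → ℝ}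
    (hΘ : IsAngleOn univ (fun z => h z - z) Θ) {β : ℝ → ℂ} (hβ : Continuous β)
    (hβh : ∀ u, β (u + 1) = h (β u)) (hloc : ∀ u v, u < v → v ≤ u + 1 → β u ≠ β v) :
    ∀ u v, u < v → β u ≠ β v := by
  by_contra! hcon
  obtain ⟨u₁, v₁, huv, he⟩ := hcon
  have hfract : ∀ u v, β u = β v → β (Int.fract u) = β (Int.fract u + (v - u)) :=
    fun u v => apply_fract_eq_of_equivariant hβh
  let K : Set (ℝ × ℝ) := (Icc 0 1 ×ˢ Icc 1 (v₁ - u₁)) ∩ {p | β p.1 = β (p.1 + p.2)}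
  have hK : IsCompact K := (isCompact_Icc.prod isCompact_Icc).inter_right
    (isClosed_eq (by fun_prop) (by fun_prop))
  have hlong : ∀ u v, u < v → β u = β v → 1 ≤ v - u := by
    intro u v huv he
    by_contra! hlt
    exact hloc u v huv (by linarith) he
  have hKne : K.Nonempty := ⟨(Int.fract u₁, v₁ - u₁),
    ⟨⟨Int.fract_nonneg _, (Int.fract_lt_one _).le⟩, hlong _ _ huv he, le_rfl⟩, hfract _ _ he⟩
  obtain ⟨⟨s, L⟩, ⟨⟨-, hL1, hL2⟩, hsL⟩, hmin⟩ := hK.exists_isMinOn hKne continuous_snd.continuousOn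
  simp only [mem_ofPred_eq] at hsL hL1 hL2
  have hL : 1 < L := by
    rcases hL1.lt_or_eq with h1 | h1
    · exact h1
    · subst h1
      exact absurd hsL (hloc s (s + 1) (by linarith) le_rfl)
  have hinj : ∀ u v, u < v → v - u < L → β u ≠ β v := by
    intro u v huv hlt he
    have := hmin (a := (Int.fract u, v - u))
      ⟨⟨⟨Int.fract_nonneg _, (Int.fract_lt_one _).le⟩, hlong _ _ huv he, by
        simp only; linarith⟩, hfract _ _ he⟩
    simp only [mem_ofPred_eq] at this
    linarith
  -- the strip of pairs of distinct parameters
  let Ω : Set (ℝ × ℝ) := {p | 0 < p.2 - p.1} ∩ {p | p.2 - p.1 < L}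
  have hΩo : IsOpen Ω := (isOpen_lt continuous_const (by fun_prop)).inter
    (isOpen_lt (by fun_prop) continuous_const)
  have hlin : IsLinearMap ℝ fun p : ℝ × ℝ => p.2 - p.1 :=
    ⟨fun x y => by simp; ring, fun c x => by simp; ring⟩
  have hΩc : Convex ℝ Ω :=
    (convex_halfSpace_gt hlin 0).inter (convex_halfSpace_lt hlin L)
  have hΩ0 : ∀ p ∈ Ω, β p.2 - β p.1 ≠ 0 := fun p hp hp0 =>
    hinj p.1 p.2 (sub_pos.1 hp.1) hp.2 (sub_eq_zero.1 hp0).symm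
  obtain ⟨Φ, hΦ⟩ := IsAngleOn.exists_of_convex hΩc hΩo
    (f := fun p => β p.2 - β p.1) (by fun_prop) hΩ0
  have hΩt0 : ∀ p ∈ Ω ×ˢ (univ : Set ℝ), F (p.2, β p.1.2) - F (p.2, β p.1.1) ≠ 0 :=
    fun p hp hp0 => hΩ0 p.1 hp.1 (sub_eq_zero.2 (hFi p.2 (sub_eq_zero.1 hp0)))
  obtain ⟨Ψ, hΨ⟩ := IsAngleOn.exists_of_convex (hΩc.prod convex_univ) (hΩo.prod isOpen_univ)
    (f := fun p : (ℝ × ℝ) × ℝ => F (p.2, β p.1.2) - F (p.2, β p.1.1)) (by fun_prop) hΩt0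
  have hΨ0 : IsAngleOn Ω (fun p => β p.2 - β p.1) (fun p => Ψ (p, 0)) :=
    (hΨ.comp (φ := fun p => (p, 0)) (by fun_prop) (fun p hp => ⟨hp, mem_univ _⟩)).congr
      (fun p _ => by simp [hF0])
  have hΨ1 : IsAngleOn Ω (fun p => β (p.2 + 1) - β (p.1 + 1)) (fun p => Ψ (p, 1)) :=
    (hΨ.comp (φ := fun p => (p, 1)) (by fun_prop) (fun p hp => ⟨hp, mem_univ _⟩)).congr
      (fun p _ => by simp [hF1, hβh])
  have hΦ1 : IsAngleOn Ω (fun p => β (p.2 + 1) - β (p.1 + 1)) (fun p => Φ (p.1 + 1, p.2 + 1)) :=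
    hΦ.comp (φ := fun p : ℝ × ℝ => (p.1 + 1, p.2 + 1)) (by fun_prop)
      (fun p hp => ⟨by simpa using hp.1, by simpa using hp.2⟩)
  obtain ⟨a, ha⟩ := hΨ0.exists_int_of_eq hΩc.isPreconnected hΦ hΩ0 (fun _ _ => rfl)
  obtain ⟨b, hb⟩ := hΨ1.exists_int_of_eq hΩc.isPreconnected hΦ1
    (fun p hp => hΩ0 (p.1 + 1, p.2 + 1) ⟨by simpa using hp.1, by simpa using hp.2⟩)
    (fun _ _ => rfl)
  -- the half turn along the loop
  have hm : ∀ p ∈ Ioo s (s + L) ×ˢ (univ : Set ℝ), ((p.1, s + L), p.2) ∈ Ω ×ˢ (univ : Set ℝ) :=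
    fun p hp => ⟨⟨by simpa using hp.1.2, by have := hp.1.1; simp; linarith⟩, mem_univ _⟩
  have hm' : ∀ p ∈ Ioo s (s + L) ×ˢ (univ : Set ℝ), ((s, p.1), p.2) ∈ Ω ×ˢ (univ : Set ℝ) :=
    fun p hp => ⟨⟨by simpa using hp.1.1, by have := hp.1.2; simp; linarith⟩, mem_univ _⟩
  obtain ⟨j, hj⟩ := (hΨ.comp (T := Ioo s (s + L) ×ˢ (univ : Set ℝ))
    (φ := fun p : ℝ × ℝ => ((p.1, s + L), p.2)) (by fun_prop) hm).exists_int_of_eq_neg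
    (((convex_Ioo _ _).prod convex_univ).isPreconnected)
    (hΨ.comp (φ := fun p : ℝ × ℝ => ((s, p.1), p.2)) (by fun_prop) hm')
    (fun p hp => hΩt0 _ (hm p hp)) (fun p hp => by simp only [← hsL]; ring)
  have hind : IsAngleOn univ (fun u => β (u + 1) - β u) (fun u => Θ (β u)) :=
    (hΘ.comp (φ := β) (by fun_prop) (mapsTo_univ _ _)).congr (fun u _ => by rw [hβh])
  have hdiag : ∀ u : ℝ, (u, u + 1) ∈ Ω := fun u => ⟨by simp, by simpa using hL⟩
  obtain ⟨c, hc⟩ := hind.exists_int_of_eq isPreconnected_univ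
    (hΦ.comp (φ := fun u => (u, u + 1)) (by fun_prop) (fun u _ => hdiag u))
    (fun u _ => hΩ0 _ (hdiag u)) (fun _ _ => rfl)
  have e1 := hj (s + 1, 0) ⟨⟨by simp, by simpa using hL⟩, mem_univ _⟩
  have e2 := hj (s + L - 1, 1) ⟨⟨by simp; linarith, by simp⟩, mem_univ _⟩
  simp only at e1 e2
  rw [ha (s + 1, s + L) ⟨by simp; linarith, by simp⟩, ha (s, s + 1) (hdiag s)] at e1
  rw [hb (s + L - 1, s + L) ⟨by simp, by simpa using hL⟩,
    hb (s, s + L - 1) ⟨by simp; linarith, by simp; linarith⟩] at e2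
  simp only [sub_add_cancel] at e2
  have c1 := hc s (mem_univ _)
  have c2 := hc (s + L) (mem_univ _)
  rw [← hsL] at c2
  have h0 : ((2 * j + 1 : ℤ) : ℝ) * Real.pi = 0 := by
    push_cast
    linarith
  rcases mul_eq_zero.1 h0 with h0 | h0
  · have := Int.cast_eq_zero.1 h0
    omega
  · exact Real.pi_ne_zero h0

theorem exists_max_norm_sub_lt {X : Type*} [NormedAddCommGroup X] [NormedSpace ℝ X] (e : X ≃ₜ X)
    {x w : X} {r : ℝ} (hr : 0 < r) (hw : ‖w - x‖ < r) (hew : ‖e w - x‖ = r) :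
    ∃ y, ‖y - x‖ < r ∧ ‖e y - x‖ < r := by
  let c : ℝ → X := fun t => x + (1 - t) • (e w - x)
  have hc : Continuous fun t => ‖e.symm (c t) - x‖ := by
    have := e.symm.continuous
    fun_prop
  have h0 : ‖e.symm (c 0) - x‖ < r := by simpa [c] using hw
  have hev : ∀ᶠ t in nhdsWithin (0 : ℝ) (Ioi 0), ‖e.symm (c t) - x‖ < r :=
    nhdsWithin_le_nhds (hc.continuousAt.eventually_lt_const h0)
  have hev' : ∀ᶠ t in nhdsWithin (0 : ℝ) (Ioi 0), t ∈ Ioo (0 : ℝ) 1 :=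
    Ioo_mem_nhdsGT one_pos
  obtain ⟨t, ht, ht0, ht1⟩ := (hev.and hev').exists
  refine ⟨e.symm (c t), ht, ?_⟩
  rw [e.apply_symm_apply]
  simp only [c, add_sub_cancel_left, norm_smul, hew, Real.norm_eq_abs]
  rw [abs_of_pos (by linarith)]
  nlinarith

/-- Around every point there is an open ball disjoint from its image, such that some point of the
bounding sphere is sent to the bounding sphere. -/
theorem exists_critical_ball {X : Type*} [NormedAddCommGroup X] [NormedSpace ℝ X] [ProperSpace X]
    (h : X ≃ₜ X) (hfix : ∀ z, h z ≠ z) (x : X) :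
    ∃ r > 0, ∃ w, ‖w - x‖ = r ∧ ‖h w - x‖ = r ∧ ∀ y, ‖y - x‖ < r → r ≤ ‖h y - x‖ := by
  let ρ : X → ℝ := fun w => max ‖w - x‖ ‖h w - x‖
  have hρ : Continuous ρ := by
    have := h.continuous
    fun_prop
  have hlim : Filter.Tendsto ρ (Filter.cocompact X) Filter.atTop := by
    refine Filter.tendsto_atTop_mono (fun w => le_max_of_le_left (norm_sub_norm_le w x)) ?_
    exact Filter.tendsto_atTop_add_const_right _ _ (tendsto_norm_cocompact_atTop)
  obtain ⟨w, hw⟩ := hρ.exists_forall_le hlim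
  have hpos : 0 < ρ w := by
    by_contra! hle
    have h1 : w = x := by
      simpa [sub_eq_zero] using (le_max_left _ _).trans hle
    have h2 : h w = x := by
      simpa [sub_eq_zero] using (le_max_right _ _).trans hle
    exact hfix w (h2.trans h1.symm)
  have hnone : ∀ y, ‖y - x‖ < ρ w → ρ w ≤ ‖h y - x‖ := by
    intro y hy
    by_contra! hlt
    exact absurd (hw y) (not_le.2 (max_lt hy hlt))
  have hle1 : ‖w - x‖ ≤ ρ w := le_max_left _ _
  have hle2 : ‖h w - x‖ ≤ ρ w := le_max_right _ _
  refine ⟨ρ w, hpos, w, ?_, ?_, hnone⟩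
  · by_contra hne
    have hlt := lt_of_le_of_ne hle1 hne
    obtain ⟨y, hy, hy'⟩ := exists_max_norm_sub_lt h hpos hlt (le_antisymm hle2 (hnone w hlt))
    exact absurd (hnone y hy) (not_le.2 hy')
  · by_contra hne
    have hlt := lt_of_le_of_ne hle2 hne
    have heq : ‖w - x‖ = ρ w := by
      rcases max_choice ‖w - x‖ ‖h w - x‖ with h1 | h1
      · exact h1.symm
      · exact absurd h1.symm hne
    obtain ⟨y, hy, hy'⟩ := exists_max_norm_sub_lt h.symm (w := h w) hpos hlt
      (by rwa [h.symm_apply_apply])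
    exact absurd (hnone (h.symm y) hy') (not_le.2 (by rwa [h.apply_symm_apply]))

theorem locallyFinite_Icc_intCast : LocallyFinite fun n : ℤ => Icc (n : ℝ) (n + 1) := by
  intro x
  refine ⟨Ioo (x - 1) (x + 1), Ioo_mem_nhds (by linarith) (by linarith),
    (finite_Icc ⌊x - 2⌋ ⌈x + 1⌉).subset ?_⟩
  rintro n ⟨y, ⟨h1, h2⟩, h3, h4⟩
  refine ⟨?_, ?_⟩
  · exact Int.floor_le_iff.2 (by linarith)
  · exact Int.le_ceil_iff.2 (by linarith)

/-- A path from `w` to `h w` extends to an equivariant path. -/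
theorem exists_equivariant_extension {X : Type*} [TopologicalSpace X] (h : X ≃ₜ X) {p : ℝ → X}
    (hp : Continuous p) (hp1 : p 1 = h (p 0)) :
    ∃ b : ℝ → X, Continuous b ∧ (∀ u, b (u + 1) = h (b u)) ∧ ∀ u ∈ Icc (0 : ℝ) 1, b u = p u := by
  have key : ∀ (n : ℤ) (u : ℝ), u ∈ Icc (n : ℝ) (n + 1) →
      (h ^ ⌊u⌋) (p (Int.fract u)) = (h ^ n) (p (u - n)) := by
    rintro n u ⟨h1, h2⟩
    rcases h2.lt_or_eq with h2 | h2
    · rw [Int.fract, Int.floor_eq_iff.2 ⟨h1, h2⟩]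
    · have hfl : ⌊u⌋ = n + 1 := Int.floor_eq_iff.2 ⟨by simp [h2], by simp [h2]⟩
      rw [Int.fract, hfl, zpow_add_one, Homeomorph.mul_apply, h2]
      simp [hp1]
  refine ⟨fun u => (h ^ ⌊u⌋) (p (Int.fract u)), ?_, fun u => ?_, fun u hu => ?_⟩
  · refine locallyFinite_Icc_intCast.continuous (iUnion_Icc_intCast ℝ) (fun _ => isClosed_Icc) ?_
    intro n
    have : Continuous fun u => (h ^ n) (p (u - n)) := by
      have := (h ^ n).continuous
      fun_prop
    exact this.continuousOn.congr (key n)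
  · simp only [Int.floor_add_one, Int.fract_add_one]
    rw [add_comm, zpow_one_add, Homeomorph.mul_apply]
  · simpa using key 0 u (by simpa using hu)

/-- Through every point there is an equivariant path, injective on intervals of length one. -/
theorem exists_equivariant_path {X : Type*} [NormedAddCommGroup X] [NormedSpace ℝ X]
    [ProperSpace X] (h : X ≃ₜ X) (hfix : ∀ z, h z ≠ z) (x : X) :
    ∃ β : ℝ → X, Continuous β ∧ (∀ u, β (u + 1) = h (β u)) ∧ β 0 = x ∧
      ∀ u v, u < v → v ≤ u + 1 → β u ≠ β v := by
  obtain ⟨r, hr, w, hw, hhw, hfree⟩ := exists_critical_ball h hfix x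
  let p : ℝ → X := fun s => x + max 0 (1 - 2 * s) • (w - x) + max 0 (2 * s - 1) • (h w - x)
  have hp : Continuous p := by fun_prop
  have pl : ∀ s, s ≤ 1 / 2 → p s - x = (1 - 2 * s) • (w - x) := by
    intro s hs
    simp only [p]
    rw [max_eq_right (by linarith), max_eq_left (by linarith)]
    simp
  have pr : ∀ s, 1 / 2 ≤ s → p s - x = (2 * s - 1) • (h w - x) := by
    intro s hs
    simp only [p]
    rw [max_eq_left (by linarith), max_eq_right (by linarith)]
    simp
  have hp0 : p 0 = w := by simpa using pl 0 (by norm_num)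
  have hp1 : p 1 = h w := by simpa [show (2 : ℝ) - 1 = 1 by norm_num] using pr 1 (by norm_num)
  have pn : ∀ s, ‖p s - x‖ = |2 * s - 1| * r := by
    intro s
    rcases le_total s (1 / 2) with hs | hs
    · rw [pl s hs, norm_smul, hw, Real.norm_eq_abs, abs_sub_comm]
    · rw [pr s hs, norm_smul, hhw, Real.norm_eq_abs]
  have pball : ∀ s, 0 < s → s < 1 → ‖p s - x‖ < r := by
    intro s h0 h1
    rw [pn]
    have : |2 * s - 1| < 1 := abs_lt.2 ⟨by linarith, by linarith⟩
    nlinarith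
  have pinj : ∀ s t, s < t → p s ≠ p t := by
    intro s t hst he
    have hn : |2 * s - 1| = |2 * t - 1| :=
      mul_right_cancel₀ hr.ne' (by rw [← pn, ← pn, he])
    rcases abs_eq_abs.1 hn with h1 | h1
    · linarith
    · have e : (1 - 2 * s) • (w - x) = (1 - 2 * s) • (h w - x) := by
        rw [← pl s (by linarith), he, pr t (by linarith)]
        congr 1
        linarith
      have := smul_right_injective X (show 1 - 2 * s ≠ 0 by intro h0; linarith) e
      exact hfix w (sub_left_injective this).symm
  obtain ⟨b, hb, hbh, hbp⟩ := exists_equivariant_extension h hp (by rw [hp1, hp0])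
  have hloc : ∀ u v, u < v → v ≤ u + 1 → b u ≠ b v := by
    intro u v huv hv he
    have he' := apply_fract_eq_of_equivariant hbh he
    have hu0 := Int.fract_nonneg u
    have hu1 := Int.fract_lt_one u
    set s := Int.fract u
    rcases le_or_gt (s + (v - u)) 1 with h1 | h1
    · rw [hbp s ⟨hu0, hu1.le⟩, hbp _ ⟨by linarith, h1⟩] at he'
      exact pinj _ _ (by linarith) he'
    · have e2 : b (s + (v - u)) = h (p (s + (v - u) - 1)) := by
        rw [← hbp _ ⟨by linarith, by linarith⟩, ← hbh, sub_add_cancel]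
      rw [hbp s ⟨hu0, hu1.le⟩, e2] at he'
      have := hfree _ (pball (s + (v - u) - 1) (by linarith) (by linarith))
      rw [← he'] at this
      exact absurd (pball s (by linarith) hu1) (not_lt.2 this)
  refine ⟨fun u => b (u + 1 / 2), by fun_prop, fun u => ?_, ?_, fun u v huv hv =>
    hloc _ _ (by linarith) (by linarith)⟩
  · simp only [← hbh, add_right_comm]
  · have := pl (1 / 2) le_rfl
    simp only [zero_add]
    rw [hbp _ ⟨by norm_num, by norm_num⟩]
    simpa [sub_eq_zero] using this

/-- The rotation of a pair of points on a line, along an isotopy from the identity to a map which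
is isotopic, relative to these points, to a translation of the line. -/
theorem rotation_eq_of_isotopic_translation {F G : ℝ × ℂ → ℂ} (hF : Continuous F)
    (hFi : ∀ t, Function.Injective fun z => F (t, z)) (hF0 : ∀ z, F (0, z) = z)
    (hG : Continuous G) (hGi : ∀ t, Function.Injective fun z => G (t, z))
    (hFG : ∀ z, G (0, z) = F (1, z)) {a : ℂ} {ε : ℝ} (hε : |ε| = 1)
    (hG1 : ∀ s : ℝ, G (1, a + s * ε) = a + s * ε + ε)
    (hGrel : ∀ t, ∀ n : ℤ, G (t, a + n * ε) = G (0, a + n * ε))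
    {m q : ℤ} (hmq : m ≠ q) (hmq' : m ≠ q + 1) {θ θ' : ℝ → ℝ}
    (hθ : IsAngleOn univ (fun t => F (t, a + q * ε) - F (t, a + m * ε)) θ)
    (hθ' : IsAngleOn univ (fun t => F (t, a + (q + 1 : ℤ) * ε) - F (t, a + m * ε)) θ') :
    θ' 1 - θ' 0 = θ 1 - θ 0 := by
  have hε0 : (ε : ℂ) ≠ 0 := by
    rintro h0
    simp [Complex.ofReal_eq_zero.1 h0] at hε
  -- the sign of the position of the segment with respect to the base point
  obtain ⟨σ, hσ, hσpos⟩ : ∃ σ : ℝ, |σ| = 1 ∧ ∀ s ∈ Ioo (-1 : ℝ) 2, 0 < σ * (q + s - m) := by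
    rcases lt_or_gt_of_ne hmq with h1 | h1
    · have : (m : ℝ) + 1 ≤ q := by exact_mod_cast h1
      exact ⟨1, by simp, fun s hs => by linarith [hs.1]⟩
    · have h2 : q + 1 < m := lt_of_le_of_ne h1 hmq'.symm
      have : (q : ℝ) + 1 + 1 ≤ m := by exact_mod_cast h2
      exact ⟨-1, by simp, fun s hs => by linarith [hs.2]⟩
  have hσσ : σ * σ = 1 := by rw [← abs_mul_abs_self, hσ, one_mul]
  let I : Set ℝ := Ioo (-1) 2
  let γ : ℝ → ℂ := fun s => a + (q + s : ℝ) * ε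
  have hγ : Continuous γ := by fun_prop
  have hγp : ∀ s ∈ I, γ s ≠ a + m * ε := by
    intro s hs he
    have h1 : ((q + s : ℝ) : ℂ) = (m : ℝ) := mul_right_cancel₀ hε0 (add_left_cancel he)
    have h2 := Complex.ofReal_injective h1
    have := hσpos s hs
    rw [h2] at this
    simp at this
  have hγ0 : γ 0 = a + q * ε := by simp [γ]
  have hγ1 : γ 1 = a + (q + 1 : ℤ) * ε := by simp [γ]
  have hIc : Convex ℝ I := convex_Ioo _ _
  have h0I : (0 : ℝ) ∈ I := ⟨by norm_num, by norm_num⟩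
  have h1I : (1 : ℝ) ∈ I := ⟨by norm_num, by norm_num⟩
  have lift : ∀ H : ℝ × ℂ → ℂ, Continuous H → (∀ t, Function.Injective fun z => H (t, z)) →
      ∃ Λ : ℝ × ℝ → ℝ, IsAngleOn (I ×ˢ (univ : Set ℝ))
        (fun p => H (p.2, γ p.1) - H (p.2, a + m * ε)) Λ := by
    intro H hH hHi
    exact IsAngleOn.exists_of_convex (hIc.prod convex_univ) (isOpen_Ioo.prod isOpen_univ)
      (by fun_prop) (fun p hp h0 => hγp p.1 hp.1 (hHi p.2 (sub_eq_zero.1 h0)))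
  obtain ⟨Λ, hΛ⟩ := lift F hF hFi
  obtain ⟨Γ, hΓ⟩ := lift G hG hGi
  have horiz : ∀ {H : ℝ × ℂ → ℂ} {Λ : ℝ × ℝ → ℝ}, IsAngleOn (I ×ˢ (univ : Set ℝ))
      (fun p => H (p.2, γ p.1) - H (p.2, a + m * ε)) Λ → ∀ t,
      IsAngleOn I (fun s => H (t, γ s) - H (t, a + m * ε)) (fun s => Λ (s, t)) :=
    fun hΛ t => hΛ.comp (φ := fun s : ℝ => (s, t)) (by fun_prop) (fun s hs => ⟨hs, mem_univ _⟩)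
  have vert : ∀ {H : ℝ × ℂ → ℂ} {Λ : ℝ × ℝ → ℝ}, IsAngleOn (I ×ˢ (univ : Set ℝ))
      (fun p => H (p.2, γ p.1) - H (p.2, a + m * ε)) Λ → ∀ s ∈ I,
      IsAngleOn univ (fun t => H (t, γ s) - H (t, a + m * ε)) (fun t => Λ (s, t)) :=
    fun hΛ s hs => hΛ.comp (φ := fun t : ℝ => (s, t)) (by fun_prop) (fun t _ => ⟨hs, mem_univ _⟩)
  have straight : ∀ {f : ℝ → ℂ} {φ : ℝ → ℝ}, IsAngleOn I f φ →
      (∀ s ∈ I, f s = γ s - (a + m * ε)) → φ 1 = φ 0 := by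
    intro f φ hφ hf
    refine hφ.eq_of_re_pos hIc.isPreconnected (g := fun s => ((σ * (q + s - m) : ℝ) : ℂ))
      (c := ((σ * ε : ℝ) : ℂ)) (by fun_prop) (fun s hs => ?_) ?_ (fun s hs => ?_) h1I h0I
      (Complex.ofReal_im _) (Complex.ofReal_im _)
    · rw [Complex.ofReal_re]
      exact hσpos s hs
    · rw [Complex.norm_real, Real.norm_eq_abs, abs_mul, hσ, hε, one_mul]
    · rw [hf s hs]
      have : (σ : ℂ) * σ = 1 := by exact_mod_cast hσσ
      simp only [γ]
      push_cast
      linear_combination (-(ε : ℂ) * (q + s - m)) * this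
  have s1 : Λ (1, 0) = Λ (0, 0) := straight (horiz hΛ 0) (fun s _ => by simp only [hF0])
  have s2 : Γ (1, 1) = Γ (0, 1) := by
    refine straight (horiz hΓ 1) (fun s _ => ?_)
    have := hG1 m
    rw [Complex.ofReal_intCast] at this
    rw [this, hG1]
    ring
  have s3 : ∀ s ∈ I, (∃ n : ℤ, γ s = a + n * ε) → Γ (s, 1) = Γ (s, 0) := by
    rintro s hs ⟨n, hn⟩
    have hc : IsAngleOn univ (fun _ : ℝ => G (0, γ s) - G (0, a + m * ε)) (fun t => Γ (s, t)) :=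
      (vert hΓ s hs).congr (fun t _ => by rw [hGrel t m, hn, hGrel t n])
    have hc' : IsAngleOn univ (fun _ : ℝ => G (0, γ s) - G (0, a + m * ε)) (fun _ => Γ (s, 0)) :=
      hc.comp (φ := fun _ => 0) continuousOn_const (mapsTo_univ _ _)
    obtain ⟨j, hj⟩ := hc.exists_int_of_eq isPreconnected_univ hc'
      (fun t _ h0 => hγp s hs (hGi 0 (sub_eq_zero.1 h0))) (fun _ _ => rfl)
    have e0 := hj 0 (mem_univ _)
    have e1 := hj 1 (mem_univ _)
    linarith
  obtain ⟨j, hj⟩ := (horiz hΛ 1).exists_int_of_eq hIc.isPreconnected (horiz hΓ 0)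
    (fun s hs h0 => hγp s hs (hFi 1 (sub_eq_zero.1 h0))) (fun s _ => by rw [hFG, hFG])
  obtain ⟨k, hk⟩ := hθ.exists_int_of_eq isPreconnected_univ (vert hΛ 0 h0I)
    (fun t _ h0 => hγp 0 h0I (hγ0.trans (hFi t (sub_eq_zero.1 h0)))) (fun t _ => by rw [hγ0])
  obtain ⟨k', hk'⟩ := hθ'.exists_int_of_eq isPreconnected_univ (vert hΛ 1 h1I)
    (fun t _ h0 => hγp 1 h1I (hγ1.trans (hFi t (sub_eq_zero.1 h0)))) (fun t _ => by rw [hγ1])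
  have a0 := s3 0 h0I ⟨q, hγ0⟩
  have a1 := s3 1 h1I ⟨q + 1, hγ1⟩
  have b0 := hj 0 h0I
  have b1 := hj 1 h1I
  have c0 := hk 0 (mem_univ _)
  have c1 := hk 1 (mem_univ _)
  have d0 := hk' 0 (mem_univ _)
  have d1 := hk' 1 (mem_univ _)
  linarith

/-- A fixed point free homeomorphism which is isotopic to the identity, and isotopic relative to
the points `a + n * ε` to a translation of the line through these points, has zero index along
curves joining two consecutive such points. -/
theorem angle_eq_of_isotopic_translation {h : ℂ ≃ₜ ℂ} (hfix : ∀ z, h z ≠ z) {F G : ℝ × ℂ → ℂ}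
    (hF : Continuous F) (hFi : ∀ t, Function.Injective fun z => F (t, z))
    (hF0 : ∀ z, F (0, z) = z) (hF1 : ∀ z, F (1, z) = h z)
    (hG : Continuous G) (hGi : ∀ t, Function.Injective fun z => G (t, z))
    (hG0 : ∀ z, G (0, z) = h z) {a : ℂ} {ε : ℝ} (hε : |ε| = 1)
    (hG1 : ∀ s : ℝ, G (1, a + s * ε) = a + s * ε + ε)
    (hGrel : ∀ t, ∀ n : ℤ, G (t, a + n * ε) = G (0, a + n * ε))
    {Θ : ℂ → ℝ} (hΘ : IsAngleOn univ (fun z => h z - z) Θ) : Θ (a + ε) = Θ a := by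
  have hFG : ∀ z, G (0, z) = F (1, z) := fun z => by rw [hG0, hF1]
  obtain ⟨β, hβ, hβh, hβ0, hloc⟩ := exists_equivariant_path h hfix a
  have hinj := injective_of_locally_injective hF hFi hF0 hF1 hΘ hβ hβh hloc
  have hx : ∀ n : ℤ, h (a + n * ε) = a + (n + 1 : ℤ) * ε := by
    intro n
    rw [← hG0, ← hGrel 1 n]
    have := hG1 n
    rw [Complex.ofReal_intCast] at this
    rw [this]
    push_cast
    ring
  have hβn : ∀ n : ℤ, β n = a + n * ε := by
    intro n
    induction n using Int.induction_on with
    | zero => simpa using hβ0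
    | succ n ih =>
      have := hx n
      rw [← ih] at this
      rw [← this, ← hβh]
      push_cast
      rfl
    | pred n ih =>
      apply h.injective
      rw [hx, ← hβh]
      convert ih using 2 <;> push_cast <;> ring
  let Ω : Set (ℝ × ℝ) := {p | p.1 < p.2}
  have hΩo : IsOpen Ω := isOpen_lt continuous_fst continuous_snd
  have hΩc : Convex ℝ Ω := by
    have : Ω = {p : ℝ × ℝ | 0 < p.2 - p.1} := by
      ext p
      exact (sub_pos (a := p.2) (b := p.1)).symm
    rw [this]
    exact convex_halfSpace_gt ⟨fun x y => by simp; ring, fun c x => by simp; ring⟩ 0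
  have hΩ0 : ∀ p ∈ Ω, β p.2 - β p.1 ≠ 0 := fun p hp h0 =>
    hinj p.1 p.2 hp (sub_eq_zero.1 h0).symm
  obtain ⟨Φ, hΦ⟩ := IsAngleOn.exists_of_convex hΩc hΩo (f := fun p => β p.2 - β p.1)
    (by fun_prop) hΩ0
  have hΩt0 : ∀ p ∈ Ω ×ˢ (univ : Set ℝ), F (p.2, β p.1.2) - F (p.2, β p.1.1) ≠ 0 :=
    fun p hp hp0 => hΩ0 p.1 hp.1 (sub_eq_zero.2 (hFi p.2 (sub_eq_zero.1 hp0)))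
  obtain ⟨Ψ, hΨ⟩ := IsAngleOn.exists_of_convex (hΩc.prod convex_univ) (hΩo.prod isOpen_univ)
    (f := fun p : (ℝ × ℝ) × ℝ => F (p.2, β p.1.2) - F (p.2, β p.1.1)) (by fun_prop) hΩt0
  have hΨ0 : IsAngleOn Ω (fun p => β p.2 - β p.1) (fun p => Ψ (p, 0)) :=
    (hΨ.comp (φ := fun p => (p, 0)) (by fun_prop) (fun p hp => ⟨hp, mem_univ _⟩)).congr
      (fun p _ => by simp [hF0])
  have hΨ1 : IsAngleOn Ω (fun p => β (p.2 + 1) - β (p.1 + 1)) (fun p => Ψ (p, 1)) :=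
    (hΨ.comp (φ := fun p => (p, 1)) (by fun_prop) (fun p hp => ⟨hp, mem_univ _⟩)).congr
      (fun p _ => by simp [hF1, hβh])
  have hs : ∀ p ∈ Ω, (p.1 + 1, p.2 + 1) ∈ Ω := fun p hp => by
    have h1 : p.1 < p.2 := hp
    show p.1 + 1 < p.2 + 1
    linarith
  have hΦ1 : IsAngleOn Ω (fun p => β (p.2 + 1) - β (p.1 + 1)) (fun p => Φ (p.1 + 1, p.2 + 1)) :=
    hΦ.comp (φ := fun p : ℝ × ℝ => (p.1 + 1, p.2 + 1)) (by fun_prop) hs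
  obtain ⟨c, hc⟩ := hΨ0.exists_int_of_eq hΩc.isPreconnected hΦ hΩ0 (fun _ _ => rfl)
  obtain ⟨d, hd⟩ := hΨ1.exists_int_of_eq hΩc.isPreconnected hΦ1
    (fun p hp => hΩ0 (p.1 + 1, p.2 + 1) (hs p hp)) (fun _ _ => rfl)
  -- the rotation of the pair `(m, n)` along the isotopy
  have hrot : ∀ u v : ℝ, u < v →
      IsAngleOn univ (fun t => F (t, β v) - F (t, β u)) (fun t => Ψ ((u, v), t)) :=
    fun u v huv => hΨ.comp (φ := fun t : ℝ => ((u, v), t)) (by fun_prop)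
      (fun t _ => ⟨huv, mem_univ _⟩)
  let R : ℤ → ℤ → ℝ := fun m n => Φ ((m + 1 : ℤ), (n + 1 : ℤ)) - Φ (m, n)
  have hR : ∀ m n : ℤ, m < n → Ψ ((m, n), 1) - Ψ ((m, n), 0) =
      R m n + 2 * Real.pi * (d - c) := by
    intro m n hmn
    have hmem : ((m : ℝ), (n : ℝ)) ∈ Ω := Int.cast_lt (R := ℝ).2 hmn
    rw [hc _ hmem, hd _ hmem]
    simp only [R]
    push_cast
    ring
  have hR1 : ∀ m n : ℤ, m < n → R m (n + 1) = R m n := by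
    intro m n hmn
    have h1 := hrot m n (Int.cast_lt.2 hmn)
    have h2 := hrot m (n + 1 : ℤ) (Int.cast_lt.2 (hmn.trans (lt_add_one n)))
    rw [hβn, hβn] at h1 h2
    have := rotation_eq_of_isotopic_translation hF hFi hF0 hG hGi hFG hε hG1 hGrel hmn.ne
      (hmn.trans (lt_add_one n)).ne h1 h2
    rw [hR _ _ hmn, hR _ _ (hmn.trans (lt_add_one n))] at this
    linarith
  have hneg : ∀ {f : ℝ → ℂ} {θ : ℝ → ℝ}, IsAngleOn univ f θ →
      IsAngleOn univ (fun t => -f t) (fun t => θ t + Real.pi) := by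
    intro f θ hθ
    refine ⟨hθ.1.add continuousOn_const, fun t ht => ?_⟩
    have := hθ.2 t ht
    push_cast
    rw [add_mul, Complex.exp_add, Complex.exp_pi_mul_I, norm_neg, mul_neg_one, mul_neg, ← this]
  have hR2 : ∀ m n : ℤ, m + 1 < n → R (m + 1) n = R m n := by
    intro m n hmn
    have hmn' : m < n := (lt_add_one m).trans hmn
    have h1 := hneg (hrot m n (Int.cast_lt.2 hmn'))
    have h2 := hneg (hrot (m + 1 : ℤ) n (Int.cast_lt.2 hmn))
    rw [hβn, hβn] at h1 h2
    simp only [neg_sub] at h1 h2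
    have := rotation_eq_of_isotopic_translation hF hFi hF0 hG hGi hFG hε hG1 hGrel hmn'.ne'
      hmn.ne' h1 h2
    have e1 := hR _ _ hmn'
    have e2 := hR _ _ hmn
    linarith
  have hRlen : ∀ (m : ℤ) (k : ℕ), R m (m + 1 + k) = R m (m + 1) := by
    intro m k
    induction k with
    | zero => simp
    | succ k ih =>
      rw [← ih, ← hR1 m (m + 1 + k) (by omega)]
      push_cast
      rw [add_assoc (m + 1) (k : ℤ) 1]
  have hRstep : ∀ m : ℤ, R (m + 1) (m + 1 + 1) = R m (m + 1) := by
    intro m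
    rw [hR2 _ _ (by omega), hR1 _ _ (by omega)]
  have hRbase : ∀ m : ℤ, R m (m + 1) = R 0 1 := by
    intro m
    induction m using Int.induction_on with
    | zero => rfl
    | succ n ih => rw [hRstep, ih]
    | pred n ih =>
      rw [← ih, ← hRstep]
      simp
  have hRconst : ∀ m n : ℤ, m < n → R m n = R 0 1 := by
    intro m n hmn
    obtain ⟨k, hk⟩ := Int.eq_ofNat_of_zero_le (show 0 ≤ n - (m + 1) by omega)
    rw [← hRbase m, ← hRlen m k, ← hk]
    congr 1
    ring
  -- far away points see the fundamental piece of the path under a small angle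
  obtain ⟨B, hB⟩ : ∃ B : ℝ, ∀ u ∈ Icc (0 : ℝ) 1, |(ε * (β u - a)).re| ≤ B := by
    obtain ⟨B, hB⟩ := isCompact_Icc.exists_bound_of_continuousOn (s := Icc (0 : ℝ) 1)
      (f := fun u => (ε * (β u - a)).re) (by fun_prop)
    exact ⟨B, hB⟩
  obtain ⟨N, hN⟩ := exists_nat_gt (max B 1)
  have hNB : B < N := (le_max_left _ _).trans_lt hN
  have hN1 : (1 : ℝ) < N := (le_max_right _ _).trans_lt hN
  have hεε : (ε : ℂ) * ε = 1 := by
    rw [← Complex.ofReal_mul, ← abs_mul_abs_self, hε]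
    simp
  have hβ1 : β 1 = a + ε := by simpa using hβn 1
  have h01 : ∀ {u : ℝ}, u = 0 ∨ u = 1 → (ε * (β u - a)).im = 0 := by
    rintro u (rfl | rfl)
    · simp [hβ0]
    · simp [hβ1]
  have hεn : ‖(ε : ℂ)‖ = 1 := by simpa using hε
  have far1 : Φ (1, (N + 1 : ℤ)) = Φ (0, (N + 1 : ℤ)) := by
    have hm : ∀ u ∈ Icc (0 : ℝ) 1, (u, ((N + 1 : ℤ) : ℝ)) ∈ Ω := fun u hu => by
      have := hu.2
      show u < _
      push_cast
      linarith
    refine (hΦ.comp (T := Icc 0 1) (φ := fun u : ℝ => (u, ((N + 1 : ℤ) : ℝ))) (by fun_prop)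
      hm).eq_of_re_pos (convex_Icc _ _).isPreconnected (c := ε)
      (g := fun u => ((N + 1 : ℝ) : ℂ) - ε * (β u - a)) (by fun_prop) (fun u hu => ?_) hεn
      (fun u hu => ?_) (by simp) (by simp) ?_ ?_
    · rw [Complex.sub_re, Complex.ofReal_re]
      linarith [(abs_le.1 (hB u hu)).2]
    · simp only [hβn]
      push_cast
      linear_combination (β u - a) * hεε
    · rw [Complex.sub_im, Complex.ofReal_im, h01 (Or.inr rfl), sub_zero]
    · rw [Complex.sub_im, Complex.ofReal_im, h01 (Or.inl rfl), sub_zero]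
  have far2 : Φ ((-N : ℤ), 1) = Φ ((-N : ℤ), 0) := by
    have hm : ∀ u ∈ Icc (0 : ℝ) 1, (((-N : ℤ) : ℝ), u) ∈ Ω := fun u hu => by
      have := hu.1
      show _ < u
      push_cast
      linarith
    refine (hΦ.comp (T := Icc 0 1) (φ := fun u : ℝ => (((-N : ℤ) : ℝ), u)) (by fun_prop)
      hm).eq_of_re_pos (convex_Icc _ _).isPreconnected (c := ε)
      (g := fun u => ((N : ℝ) : ℂ) + ε * (β u - a)) (by fun_prop) (fun u hu => ?_) hεn
      (fun u hu => ?_) (by simp) (by simp) ?_ ?_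
    · rw [Complex.add_re, Complex.ofReal_re]
      linarith [(abs_le.1 (hB u hu)).1]
    · simp only [hβn]
      push_cast
      linear_combination -(β u - a) * hεε
    · rw [Complex.add_im, Complex.ofReal_im, h01 (Or.inr rfl), add_zero]
    · rw [Complex.add_im, Complex.ofReal_im, h01 (Or.inl rfl), add_zero]
  -- transport of the second estimate to the far end of the path
  have htrans : ∀ (k : ℕ) (n : ℤ), -(N : ℤ) < n →
      Φ ((-N + k : ℤ), (n + k : ℤ)) = Φ ((-N : ℤ), n) + k * R 0 1 := by
    intro k n hn
    induction k with
    | zero => simp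
    | succ k ih =>
      have := hRconst (-N + k) (n + k) (by omega)
      simp only [R] at this ih ⊢
      push_cast at this ih ⊢
      rw [← add_assoc, ← add_assoc]
      linarith
  have t0 := htrans N 0 (by have : 0 < N := by exact_mod_cast (zero_lt_one.trans hN1)
                            omega)
  have t1 := htrans N 1 (by omega)
  have r := hRconst 0 N (by exact_mod_cast (zero_lt_one.trans hN1))
  have r1 : R 0 1 = Φ (1, 2) - Φ (0, 1) := by norm_num [R]
  have hind : IsAngleOn univ (fun u => β (u + 1) - β u) (fun u => Θ (β u)) :=
    (hΘ.comp (φ := β) (by fun_prop) (mapsTo_univ _ _)).congr (fun u _ => by rw [hβh])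
  have hdiag : ∀ u : ℝ, (u, u + 1) ∈ Ω := fun u => lt_add_one u
  obtain ⟨j, hj⟩ := hind.exists_int_of_eq isPreconnected_univ
    (hΦ.comp (φ := fun u => (u, u + 1)) (by fun_prop) (fun u _ => hdiag u))
    (fun u _ => hΩ0 _ (hdiag u)) (fun _ _ => rfl)
  have j0 := hj 0 (mem_univ _)
  have j1 := hj 1 (mem_univ _)
  simp only [R] at r r1 t0 t1
  push_cast at r r1 t0 t1 far1 far2
  norm_num at r r1 t0 t1 j0 j1 far1 far2
  rw [hβ1] at j1
  rw [hβ0] at j0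
  rw [add_comm (1 : ℝ) N] at t1
  linarith

theorem IsotopicRel.exists_complex_isotopy {f g : Plane → Plane} {O : Set Plane}
    (hfg : IsotopicRel f g O) : ∃ F : ℝ × ℂ → ℂ, Continuous F ∧
      (∀ t, Function.Injective fun z => F (t, z)) ∧
      (∀ p : Plane, F (0, Complex.equivRealProdCLM.symm p) =
        Complex.equivRealProdCLM.symm (f p)) ∧
      (∀ p : Plane, F (1, Complex.equivRealProdCLM.symm p) =
        Complex.equivRealProdCLM.symm (g p)) ∧
      ∀ t, ∀ p ∈ O, F (t, Complex.equivRealProdCLM.symm p) =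
        Complex.equivRealProdCLM.symm (f p) := by
  obtain ⟨F, hF, hFi, hF0, hF1, hFO⟩ := hfg
  refine ⟨fun x => Complex.equivRealProdCLM.symm
    (F (projIcc (0 : ℝ) 1 zero_le_one x.1, Complex.equivRealProdCLM x.2)), ?_, ?_, ?_, ?_, ?_⟩
  · have := continuous_projIcc (a := (0 : ℝ)) (b := 1) (h := zero_le_one)
    fun_prop
  · intro t z w hzw
    obtain ⟨e, he⟩ := hFi _ (projIcc (0 : ℝ) 1 zero_le_one t).2
    have h1 := Complex.equivRealProdCLM.symm.injective hzw
    exact Complex.equivRealProdCLM.injective (e.injective ((he _).trans (h1.trans (he _).symm)))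
  · intro p
    simp only [projIcc_left, ContinuousLinearEquiv.apply_symm_apply, hF0]
  · intro p
    simp only [projIcc_right, ContinuousLinearEquiv.apply_symm_apply, hF1]
  · intro t p hp
    simp only [ContinuousLinearEquiv.apply_symm_apply]
    rw [hFO _ (projIcc (0 : ℝ) 1 zero_le_one t).2 p hp]

theorem angle_eq_on_integer_points {h g : Plane ≃ₜ Plane} (hB : IsBrouwer h) {O : Set Plane}
    (hiso : IsotopicRel h g O) {c ε : ℝ} (hε : ε = 1 ∨ ε = -1) (hO : ∀ n : ℤ, ((n : ℝ), c) ∈ O)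
    (hg : ∀ x : ℝ, g (x, c) = (x + ε, c)) {Θ : ℂ → ℝ}
    (hΘ : IsAngleOn univ (fun z => Complex.equivRealProdCLM.symm
      (h (Complex.equivRealProdCLM z)) - z) Θ) (n : ℤ) :
    Θ (Complex.equivRealProdCLM.symm ((n : ℝ), c)) =
      Θ (Complex.equivRealProdCLM.symm ((0 : ℝ), c)) := by
  obtain ⟨F, hF, hFi, hF0, hF1, -⟩ := hB.1.exists_complex_isotopy
  obtain ⟨G, hG, hGi, hG0, hG1, hGO⟩ := hiso.exists_complex_isotopy
  let q := Complex.equivRealProdCLM.symm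
  have hq : ∀ x y : ℝ, q (x + y, c) = q (x, c) + y := fun x y => by
    simp only [q, Complex.equivRealProdCLM_symm_apply]
    push_cast
    ring
  let k : ℂ ≃ₜ ℂ := (q.symm.toHomeomorph.trans h).trans q.toHomeomorph
  have hk : ∀ z, k z = q (h (Complex.equivRealProdCLM z)) := fun z => rfl
  have hqz : ∀ z, Complex.equivRealProdCLM.symm (Complex.equivRealProdCLM z) = z :=
    Complex.equivRealProdCLM.symm_apply_apply
  have hint : ∀ m l : ℤ, ∃ j : ℤ, (m : ℝ) + l * ε = j := fun m l => by
    rcases hε with rfl | rfl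
    · exact ⟨m + l, by push_cast; ring⟩
    · exact ⟨m - l, by push_cast; ring⟩
  have step : ∀ m : ℤ, Θ (q ((m : ℝ), c) + ε) = Θ (q ((m : ℝ), c)) := fun m =>
    angle_eq_of_isotopic_translation (h := k) (F := F) (G := G)
      (fun z hz => hB.2 (Complex.equivRealProdCLM z) (q.injective (by
        rw [← hk, hz]; exact (hqz z).symm)))
      hF hFi
      (fun z => by simpa only [hqz, id] using hF0 (Complex.equivRealProdCLM z))
      (fun z => by simpa only [hqz, hk] using hF1 (Complex.equivRealProdCLM z))
      hG hGi
      (fun z => by simpa only [hqz, hk] using hG0 (Complex.equivRealProdCLM z))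
      (by rcases hε with rfl | rfl <;> simp)
      (fun s => by
        have h1 := hG1 ((m : ℝ) + s * ε, c)
        rw [hg] at h1
        change G (1, q _) = q _ at h1
        rw [hq, hq, hq] at h1
        push_cast at h1
        exact h1)
      (fun t l => by
        obtain ⟨j, hj⟩ := hint m l
        have h1 : q ((m : ℝ), c) + l * ε = q ((j : ℝ), c) := by
          rw [← hj, hq]
          push_cast
          ring
        rw [h1]
        exact (hGO t _ (hO j)).trans (hG0 _).symm)
      hΘ
  have succ : ∀ m : ℤ, Θ (q (((m + 1 : ℤ) : ℝ), c)) = Θ (q ((m : ℝ), c)) := fun m => by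
    rcases hε with rfl | rfl
    · rw [← step m, ← hq]
      push_cast
      rfl
    · rw [← step (m + 1), ← hq]
      push_cast
      simp
  change Θ (q _) = Θ (q _)
  induction n using Int.induction_on with
  | zero => simp
  | succ n ih => rw [succ, ih]
  | pred n ih => rw [← ih, ← succ, sub_add_cancel]

theorem IsAngleFunction.isAngleOn {f : Plane → Plane} {γ : ℝ → Plane} {θ : ℝ → ℝ}
    (hθ : IsAngleFunction f γ θ) : IsAngleOn (Icc 0 1)
      (fun t => Complex.equivRealProdCLM.symm (f (γ t)) - Complex.equivRealProdCLM.symm (γ t))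
      θ := by
  refine ⟨hθ.1, fun t ht => ?_⟩
  have hn : ∀ p : Plane, ‖Complex.equivRealProdCLM.symm p‖ = planeNorm p := fun p => by
    rw [Complex.equivRealProdCLM_symm_apply, Complex.norm_add_mul_I, planeNorm]
  simp only [← map_sub, hn]
  conv_lhs => rw [hθ.2 t ht]
  rw [map_smul, Complex.equivRealProdCLM_symm_apply, Complex.real_smul, Complex.exp_mul_I]
  simp

theorem IsAngleFunction.sub_eq {h : Plane ≃ₜ Plane} (hfix : ∀ x, h x ≠ x) {γ : ℝ → Plane}
    (hγ : ContinuousOn γ (Icc 0 1)) {θ : ℝ → ℝ} (hθ : IsAngleFunction h γ θ) {Θ : ℂ → ℝ}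
    (hΘ : IsAngleOn univ (fun z => Complex.equivRealProdCLM.symm
      (h (Complex.equivRealProdCLM z)) - z) Θ) :
    θ 1 - θ 0 = Θ (Complex.equivRealProdCLM.symm (γ 1)) -
      Θ (Complex.equivRealProdCLM.symm (γ 0)) := by
  have h1 := hΘ.comp (φ := fun t => Complex.equivRealProdCLM.symm (γ t)) (T := Icc 0 1)
    (by fun_prop) (mapsTo_univ _ _)
  obtain ⟨j, hj⟩ := hθ.isAngleOn.exists_int_of_eq isPreconnected_Icc h1
    (fun t _ h0 => hfix (γ t) (Complex.equivRealProdCLM.symm.injective (sub_eq_zero.1 h0)))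
    (fun t _ => by simp)
  rw [hj 1 (right_mem_Icc.2 zero_le_one), hj 0 (left_mem_Icc.2 zero_le_one)]
  ring

/-- Independence of the index on the curve, for a Brouwer
homeomorphism preserving `ℤ₁` and `ℤ₂` whose mapping class is that of `T`,
`T⁻¹`, `R` or `R⁻¹`. -/
theorem index_independent_of_curve
    (h : Plane ≃ₜ Plane) (hB : IsBrouwer h)
    (h1 : h '' Z1 = Z1) (h2 : h '' Z2 = Z2)
    (ε₁ ε₂ : ℝ) (hε₁ : ε₁ = 1 ∨ ε₁ = -1) (hε₂ : ε₂ = 1 ∨ ε₂ = -1)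
    (g : Plane ≃ₜ Plane)
    (hg1 : ∀ x : ℝ, g (x, 1) = (x + ε₁, 1))
    (hg2 : ∀ x : ℝ, g (x, 2) = (x + ε₂, 2))
    (hiso : IsotopicRel (⇑h) (⇑g) (Z1 ∪ Z2))
    (γ γ' : ℝ → Plane)
    (hγ : ContinuousOn γ (Icc 0 1)) (hγ' : ContinuousOn γ' (Icc 0 1))
    (hγ0 : γ 0 ∈ Z1) (hγ1 : γ 1 ∈ Z2) (hγ'0 : γ' 0 ∈ Z1) (hγ'1 : γ' 1 ∈ Z2)
    (θ θ' : ℝ → ℝ)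
    (hθ : IsAngleFunction (⇑h) γ θ) (hθ' : IsAngleFunction (⇑h) γ' θ') :
    θ 1 - θ 0 = θ' 1 - θ' 0 := by
  obtain ⟨Θ, hΘ⟩ := IsAngleOn.exists_of_convex (S := univ) (f := fun z : ℂ =>
    Complex.equivRealProdCLM.symm (h (Complex.equivRealProdCLM z)) - z) convex_univ isOpen_univ
    (by fun_prop) (fun z _ h0 => hB.2 (Complex.equivRealProdCLM z)
      (Complex.equivRealProdCLM.symm.injective ((sub_eq_zero.1 h0).trans
        (Complex.equivRealProdCLM.symm_apply_apply z).symm)))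
  have hΘ1 := angle_eq_on_integer_points hB hiso hε₁ (fun n => Or.inl ⟨n, rfl⟩) hg1 hΘ
  have hΘ2 := angle_eq_on_integer_points hB hiso hε₂ (fun n => Or.inr ⟨n, rfl⟩) hg2 hΘ
  rw [hθ.sub_eq hB.2 hγ hΘ, hθ'.sub_eq hB.2 hγ' hΘ]
  obtain ⟨m, hm⟩ := hγ0
  obtain ⟨n, hn⟩ := hγ1
  obtain ⟨m', hm'⟩ := hγ'0
  obtain ⟨n', hn'⟩ := hγ'1
  rw [hm, hn, hm', hn', hΘ1, hΘ1, hΘ2, hΘ2]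
end

section
/- Invariance of the index under conjugation by a homeomorphism commuting with the translation: let h and Φ be orientation preserving homeomorphisms of ℝ² with h(ℤ₁) = ℤ₁, h(ℤ₂) = ℤ₂, Φ(ℤ₁) = ℤ₁, Φ(ℤ₂) = ℤ₂, assume h is fixed point free and Φ∘T = T∘Φ. Then for any continuous curve γ : [0,1] → ℝ² with γ(0) ∈ ℤ₁ and γ(1) ∈ ℤ₂, any angle function θ for h along γ, and any angle function θ′ for Φ∘h∘Φ⁻¹ along Φ∘γ, one has θ(1) − θ(0) = θ′(1) − θ′(0). -/
open Set

/-- The identification of the plane with `ℂ`. -/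
noncomputable def planeToComplex (p : Plane) : ℂ := p.1 + p.2 * Complex.I

lemma planeToComplex_re (p : Plane) : (planeToComplex p).re = p.1 := by
  simp [planeToComplex]

lemma planeToComplex_im (p : Plane) : (planeToComplex p).im = p.2 := by
  simp [planeToComplex]

lemma planeToComplex_sub (p q : Plane) :
    planeToComplex (p - q) = planeToComplex p - planeToComplex q := by
  simp only [planeToComplex, Prod.fst_sub, Prod.snd_sub]
  push_cast
  ring

lemma planeToComplex_injective : Function.Injective planeToComplex := fun p q hpq =>
  Prod.ext (by rw [← planeToComplex_re, hpq, planeToComplex_re])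
    (by rw [← planeToComplex_im, hpq, planeToComplex_im])

lemma continuous_planeToComplex : Continuous planeToComplex := by
  unfold planeToComplex
  fun_prop

lemma planeToComplex_sub_ne_zero {p q : Plane} (hpq : p ≠ q) :
    planeToComplex q - planeToComplex p ≠ 0 :=
  sub_ne_zero.2 fun h => hpq (planeToComplex_injective h).symm

lemma planeNorm_sub_pos {p q : Plane} (hpq : p ≠ q) : 0 < planeNorm (p - q) := by
  refine Real.sqrt_pos.2 ?_
  by_contra! hle
  have h1 : (p - q).1 = 0 := by nlinarith [sq_nonneg (p - q).1, sq_nonneg (p - q).2]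
  have h2 : (p - q).2 = 0 := by nlinarith [sq_nonneg (p - q).1, sq_nonneg (p - q).2]
  exact hpq (sub_eq_zero.1 (Prod.ext h1 h2))

/-- In polar form, the angle is determined up to a multiple of `2π`. -/
lemma exists_int_of_polar_eq {r s a b : ℝ} (hr : 0 < r) (hs : 0 < s)
    (h : (r : ℂ) * Complex.exp (a * Complex.I) = s * Complex.exp (b * Complex.I)) :
    ∃ n : ℤ, a - b = n * (2 * Real.pi) := by
  have hrs : r = s := by
    have := congrArg norm h
    simpa [Complex.norm_exp_ofReal_mul_I, abs_of_pos hr, abs_of_pos hs] using this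
  subst hrs
  have h' := mul_left_cancel₀ (by exact_mod_cast hr.ne') h
  obtain ⟨n, hn⟩ := Complex.exp_eq_exp_iff_exists_int.1 h'
  refine ⟨n, ?_⟩
  have := congrArg Complex.im hn
  simp at this
  linarith

/-- The angle variation of `F t q - F t p` along an isotopy `F` from the identity to `Φ` is a
continuous symmetric function of the pair `(p, q)` of distinct points, and it relates the
directions of `q - p` and `Φ q - Φ p`. -/
lemma OrientationPreserving.exists_rotation {Φ : Plane ≃ₜ Plane} (hΦ : OrientationPreserving Φ) :
    ∃ D : Plane × Plane → ℝ, ContinuousOn D {p | p.1 ≠ p.2} ∧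
      (∀ p q, D (p, q) = D (q, p)) ∧
      ∀ p q, p ≠ q → ∃ r : ℝ, 0 < r ∧ planeToComplex (Φ q - Φ p) =
        r * Complex.exp (D (p, q) * Complex.I) * planeToComplex (q - p) := by
  obtain ⟨F, hF, hhom, hF0, hF1, -⟩ := hΦ
  let A := {p : Plane × Plane // p.1 ≠ p.2}
  have hne (t : unitInterval) (p : A) : F (t, p.1.1) ≠ F (t, p.1.2) := by
    obtain ⟨e, he⟩ := hhom t t.2
    exact fun h => p.2 (e.injective ((he _).trans (h.trans (he _).symm)))
  let H : C(unitInterval × A, {z : ℂ // z ≠ 0}) :=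
    { toFun := fun x => ⟨(planeToComplex (F (x.1, x.2.1.2)) - planeToComplex (F (x.1, x.2.1.1))) /
          (planeToComplex x.2.1.2 - planeToComplex x.2.1.1),
        div_ne_zero (planeToComplex_sub_ne_zero (hne x.1 x.2))
          (planeToComplex_sub_ne_zero x.2.2)⟩
      continuous_toFun := by
        have hval : Continuous fun x : unitInterval × A => x.2.1 :=
          continuous_subtype_val.comp continuous_snd
        have htime : Continuous fun x : unitInterval × A => (x.1 : ℝ) :=
          continuous_subtype_val.comp continuous_fst
        have hcont := continuous_planeToComplex
        exact Continuous.subtype_mk (Continuous.div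
          ((hcont.comp (hF.comp (htime.prodMk hval.snd))).sub
            (hcont.comp (hF.comp (htime.prodMk hval.fst))))
          ((hcont.comp hval.snd).sub (hcont.comp hval.fst))
          fun x => planeToComplex_sub_ne_zero x.2.2) _ }
  have H_zero (a : A) : H (0, a) = ⟨Complex.exp ((0 : C(A, ℂ)) a), Complex.exp_ne_zero _⟩ := by
    refine Subtype.ext ?_
    simp only [H, ContinuousMap.coe_mk, Set.Icc.coe_zero, hF0, id]
    exact (div_self (planeToComplex_sub_ne_zero a.2)).trans Complex.exp_zero.symm
  let L := Complex.isCoveringMap_exp.liftHomotopy H 0 H_zero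
  have hL (x : unitInterval × A) : Complex.exp (L x) = (H x).1 :=
    congrArg Subtype.val (congrFun (Complex.isCoveringMap_exp.liftHomotopy_lifts H 0 H_zero) x)
  have hL0 (a : A) : L (0, a) = 0 := Complex.isCoveringMap_exp.liftHomotopy_zero H 0 H_zero a
  let swap : A → A := fun a => ⟨(a.1.2, a.1.1), a.2.symm⟩
  have hswap : Continuous swap := by
    refine Continuous.subtype_mk ?_ _
    fun_prop
  have hsymm : (fun x : unitInterval × A => L (x.1, swap x.2)) = L := by
    refine (Complex.isCoveringMap_exp.eq_liftHomotopy_iff H_zero _).2 ⟨fun a => ?_, ?_, ?_⟩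
    · fun_prop
    · funext x
      refine Subtype.ext ((hL _).trans ?_)
      simp only [H, swap, ContinuousMap.coe_mk]
      rw [← neg_sub (planeToComplex x.2.1.2), ← neg_sub (planeToComplex (F (x.1, x.2.1.2))),
        neg_div_neg_eq]
    · exact fun a => hL0 _
  classical
  refine ⟨fun p => if hp : p.1 ≠ p.2 then (L (1, ⟨p, hp⟩)).im else 0, ?_, ?_, ?_⟩
  · rw [continuousOn_iff_continuous_domRestrict]
    have : Continuous fun a : A => (L (1, a)).im := by fun_prop
    refine this.congr fun a => ?_
    have ha : a.1.1 ≠ a.1.2 := a.2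
    simp only [Set.domRestrict_apply]
    rw [dif_pos ha]
  · intro p q
    by_cases hpq : p = q
    · subst hpq; rfl
    · have hqp : q ≠ p := fun h => hpq h.symm
      simp only [ne_eq, hpq, hqp, not_false_eq_true, dite_true]
      exact congrArg Complex.im (congrFun hsymm (1, ⟨(p, q), hpq⟩)).symm
  · intro p q hpq
    refine ⟨Real.exp (L (1, ⟨(p, q), hpq⟩)).re, Real.exp_pos _, ?_⟩
    have h1 := hL (1, ⟨(p, q), hpq⟩)
    simp only [H, ContinuousMap.coe_mk, Set.Icc.coe_one, hF1] at h1
    rw [eq_div_iff (planeToComplex_sub_ne_zero hpq)] at h1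
    simp only [ne_eq, hpq, not_false_eq_true, dite_true]
    rw [planeToComplex_sub, planeToComplex_sub, ← h1, Complex.ofReal_exp, ← Complex.exp_add,
      Complex.re_add_im]

/-- A continuous function avoiding the angles with negative sine takes at most one value
in `2πℤ` on a preconnected set. -/
lemma IsPreconnected.eq_of_sin_nonneg {X : Type*} [TopologicalSpace X] {S : Set X}
    (hS : IsPreconnected S) {f : X → ℝ} (hf : ContinuousOn f S)
    (hsin : ∀ x ∈ S, 0 ≤ Real.sin (f x)) {x y : X} (hx : x ∈ S) (hy : y ∈ S)
    (hfx : ∃ n : ℤ, f x = n * (2 * Real.pi)) (hfy : ∃ n : ℤ, f y = n * (2 * Real.pi)) :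
    f x = f y := by
  have key : ∀ x ∈ S, ∀ y ∈ S, ∀ n m : ℤ, f x = n * (2 * Real.pi) → f y = m * (2 * Real.pi) →
      m ≤ n := by
    intro x hx y hy n m hn hm
    by_contra! hlt
    have hlt' : (n : ℝ) + 1 ≤ m := by exact_mod_cast hlt
    have hpi := Real.pi_pos
    obtain ⟨z, hz, hfz⟩ := hS.intermediate_value hx hy hf
      (show -(Real.pi / 2) + (n + 1 : ℤ) * (2 * Real.pi) ∈ Icc (f x) (f y) by
        rw [hn, hm]
        push_cast
        constructor <;> nlinarith)
    have := hsin z hz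
    rw [hfz, Real.sin_add_int_mul_two_pi, Real.sin_neg, Real.sin_pi_div_two] at this
    linarith
  obtain ⟨n, hn⟩ := hfx
  obtain ⟨m, hm⟩ := hfy
  rw [hn, hm, le_antisymm (key y hy x hx m n hm hn) (key x hx y hy n m hn hm)]

lemma apply_add_int {Φ : Plane ≃ₜ Plane} (hcomm : ∀ p, Φ (T p) = T (Φ p)) (k : ℤ) (p : Plane) :
    Φ (p + ((k : ℝ), 0)) = Φ p + ((k : ℝ), 0) := by
  have hT (p : Plane) : T p = p + (1, 0) := by ext <;> simp [T, shear]
  have hsucc (p : Plane) : Φ (p + (1, 0)) = Φ p + (1, 0) := by rw [← hT, hcomm, hT]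
  induction k generalizing p with
  | zero => simp [← Prod.zero_eq_mk]
  | succ k ih =>
    have e : ((((k : ℤ) + 1 : ℤ) : ℝ), (0 : ℝ)) = (((k : ℤ) : ℝ), (0 : ℝ)) + (1, 0) := by
      ext <;> simp
    rw [e, ← add_assoc, hsucc, ih, add_assoc]
  | pred k ih =>
    have e : (((-(k : ℤ) : ℤ) : ℝ), (0 : ℝ)) = (((-(k : ℤ) - 1 : ℤ) : ℝ), (0 : ℝ)) + (1, 0) := by
      ext <;> simp
    have := ih p
    rw [e, ← add_assoc, hsucc, ← add_assoc] at this
    exact add_right_cancel this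

/-- On each horizontal line, the height of a homeomorphism commuting with `T` has a minimum. -/
lemma exists_min_height {Φ : Plane ≃ₜ Plane} (hcomm : ∀ p, Φ (T p) = T (Φ p)) :
    ∃ p : Plane, ∀ s : ℝ, (Φ p).2 ≤ (Φ (p + (s, 0))).2 := by
  have hper : Function.Periodic (fun s : ℝ => (Φ (s, 0)).2) 1 := by
    intro s
    have := apply_add_int hcomm 1 (s, 0)
    simp only [Int.cast_one, Prod.mk_add_mk, add_zero] at this
    simp [this]
  obtain ⟨s₀, -, hs₀⟩ := (isCompact_Icc (a := (0 : ℝ)) (b := 1)).exists_isMinOn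
    (nonempty_Icc.2 zero_le_one)
    (show ContinuousOn (fun s : ℝ => (Φ (s, 0)).2) (Icc 0 1) by fun_prop)
  refine ⟨(s₀, 0), fun s => ?_⟩
  obtain ⟨u, hu, hsu⟩ := hper.exists_mem_Ico₀ zero_lt_one (s₀ + s)
  have := hs₀ (Ico_subset_Icc_self hu)
  simp only [mem_ofPred_eq] at this hsu
  simpa [hsu] using this

/-- The rotation of `Φ` is the same on all pairs of points differing by a nonzero integer
horizontal translation. -/
lemma rotation_add_int_eq {Φ : Plane ≃ₜ Plane} (hcomm : ∀ p, Φ (T p) = T (Φ p))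
    {D : Plane × Plane → ℝ} (hD : ContinuousOn D {p | p.1 ≠ p.2})
    (hsymm : ∀ p q, D (p, q) = D (q, p))
    (hrot : ∀ p q, p ≠ q → ∃ r : ℝ, 0 < r ∧ planeToComplex (Φ q - Φ p) =
        r * Complex.exp (D (p, q) * Complex.I) * planeToComplex (q - p)) :
    ∃ c : ℝ, ∀ (p : Plane) (k : ℤ), k ≠ 0 → D (p, p + ((k : ℝ), 0)) = c := by
  have hne (p : Plane) {s : ℝ} (hs : s ≠ 0) : p ≠ p + (s, 0) := by
    intro h
    exact hs (by simpa using congrArg Prod.fst h)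
  have hint (p : Plane) {k : ℤ} (hk : k ≠ 0) :
      ∃ n : ℤ, D (p, p + ((k : ℝ), 0)) = n * (2 * Real.pi) := by
    have hk' : (k : ℝ) ≠ 0 := by exact_mod_cast hk
    obtain ⟨r, hr, h⟩ := hrot p _ (hne p hk')
    rw [apply_add_int hcomm, add_sub_cancel_left, add_sub_cancel_left] at h
    have hz : planeToComplex ((k : ℝ), 0) ≠ 0 := by
      simpa [planeToComplex] using hk
    have h1 : (r : ℂ) * Complex.exp (D (p, p + ((k : ℝ), 0)) * Complex.I) =
        (1 : ℝ) * Complex.exp ((0 : ℝ) * Complex.I) := by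
      refine mul_right_cancel₀ hz (h.symm.trans ?_)
      simp
    simpa using exists_int_of_polar_eq hr one_pos h1
  have hbase (p q : Plane) {k : ℤ} (hk : k ≠ 0) :
      D (p, p + ((k : ℝ), 0)) = D (q, q + ((k : ℝ), 0)) := by
    refine isPreconnected_univ.eq_of_sin_nonneg (f := fun p : Plane => D (p, p + ((k : ℝ), 0)))
      (hD.comp (by fun_prop) fun p _ => hne p (by exact_mod_cast hk)) (fun p _ => ?_)
      (mem_univ p) (mem_univ q) (hint p hk) (hint q hk)
    obtain ⟨n, hn⟩ := hint p hk
    simp only [hn]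
    have := Real.sin_add_int_mul_two_pi 0 n
    rw [zero_add, Real.sin_zero] at this
    exact this.ge
  obtain ⟨p₀, hp₀⟩ := exists_min_height hcomm
  have hray {k : ℤ} (hk : 0 < k) :
      D (p₀, p₀ + ((k : ℝ), 0)) = D (p₀, p₀ + (((1 : ℤ) : ℝ), 0)) := by
    refine (isPreconnected_Ioi (a := (0 : ℝ))).eq_of_sin_nonneg
      (f := fun s : ℝ => D (p₀, p₀ + (s, 0)))
      (hD.comp (by fun_prop) fun s hs => hne p₀ (ne_of_gt hs)) (fun s hs => ?_)
      (mem_Ioi.2 (by exact_mod_cast hk)) (by simp) (hint p₀ hk.ne') (hint p₀ one_ne_zero)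
    obtain ⟨r, hr, h⟩ := hrot p₀ _ (hne p₀ (ne_of_gt hs))
    have him := congrArg Complex.im h
    have hs' : planeToComplex (p₀ + (s, 0) - p₀) = (s : ℂ) := by simp [planeToComplex]
    rw [planeToComplex_im, hs', mul_assoc, Complex.im_ofReal_mul, Complex.im_mul_ofReal,
      Complex.exp_ofReal_mul_I_im, Prod.snd_sub] at him
    have h0 := hp₀ s
    by_contra! hneg
    nlinarith [mul_pos hr hs, mul_pos (mul_pos hr hs) (neg_pos.2 hneg)]
  refine ⟨D (p₀, p₀ + (((1 : ℤ) : ℝ), 0)), fun p k hk => ?_⟩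
  rcases hk.lt_or_gt with hk' | hk'
  · have hback : p = p + ((k : ℝ), 0) + (((-k : ℤ) : ℝ), 0) := by
      ext <;> simp
    have hmk : (-k : ℤ) ≠ 0 := neg_ne_zero.2 hk
    rw [hsymm]
    conv_lhs => rw [show D (p + ((k : ℝ), 0), p) =
      D (p + ((k : ℝ), 0), p + ((k : ℝ), 0) + (((-k : ℤ) : ℝ), 0)) by rw [← hback]]
    rw [hbase _ p₀ hmk, hray (by omega)]
  · rw [hbase p p₀ hk, hray hk']

lemma IsAngleFunction.planeToComplex_eq {f : Plane → Plane} {γ : ℝ → Plane} {θ : ℝ → ℝ}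
    (hθ : IsAngleFunction f γ θ) {t : ℝ} (ht : t ∈ Icc (0 : ℝ) 1) :
    planeToComplex (f (γ t) - γ t) =
      planeNorm (f (γ t) - γ t) * Complex.exp (θ t * Complex.I) := by
  have h1 := congrArg planeToComplex (hθ.2 t ht)
  refine h1.trans ?_
  rw [Complex.exp_mul_I]
  simp only [planeToComplex, Prod.smul_fst, Prod.smul_snd, smul_eq_mul]
  push_cast
  ring

/-- Invariance of the index under conjugation by a
homeomorphism commuting with the translation. -/
theorem index_invariant_under_commuting_conjugacy
    (h Φ : Plane ≃ₜ Plane)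
    (hOPh : OrientationPreserving h) (hOPΦ : OrientationPreserving Φ)
    (hh1 : h '' Z1 = Z1) (hh2 : h '' Z2 = Z2)
    (hΦ1 : Φ '' Z1 = Z1) (hΦ2 : Φ '' Z2 = Z2)
    (hfpf : ∀ x, h x ≠ x)
    (hcomm : ∀ p, Φ (T p) = T (Φ p))
    (γ : ℝ → Plane) (hγ : ContinuousOn γ (Icc 0 1))
    (hγ0 : γ 0 ∈ Z1) (hγ1 : γ 1 ∈ Z2)
    (θ θ' : ℝ → ℝ)
    (hθ : IsAngleFunction (⇑h) γ θ)
    (hθ' : IsAngleFunction (⇑(conjH Φ h)) (fun t => Φ (γ t)) θ') :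
    θ 1 - θ 0 = θ' 1 - θ' 0 := by
  obtain ⟨D, hD, hsymm, hrot⟩ := hOPΦ.exists_rotation
  obtain ⟨c, hc⟩ := rotation_add_int_eq hcomm hD hsymm hrot
  have hline {y : ℝ} {p : Plane} (hp : ∃ n : ℤ, p = ((n : ℝ), y))
      (hhp : ∃ n : ℤ, h p = ((n : ℝ), y)) : D (p, h p) = c := by
    obtain ⟨n, hn⟩ := hp
    obtain ⟨m, hm⟩ := hhp
    have hnm : m - n ≠ 0 := by
      intro h0
      exact hfpf p (by rw [hm, hn, sub_eq_zero.1 h0])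
    rw [← hc p (m - n) hnm, hm, hn]
    simp
  have hD0 : D (γ 0, h (γ 0)) = c := hline hγ0 (hh1.subset (mem_image_of_mem h hγ0))
  have hD1 : D (γ 1, h (γ 1)) = c := hline hγ1 (hh2.subset (mem_image_of_mem h hγ1))
  have hconj (p : Plane) : conjH Φ h (Φ p) = Φ (h p) := by simp [conjH]
  have hint : ∀ t ∈ Icc (0 : ℝ) 1,
      ∃ n : ℤ, θ' t - (D (γ t, h (γ t)) + θ t) = n * (2 * Real.pi) := by
    intro t ht
    have e := hθ.planeToComplex_eq ht
    have e' := hθ'.planeToComplex_eq ht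
    obtain ⟨r, hr, hrt⟩ := hrot _ _ (hfpf (γ t)).symm
    simp only [hconj] at e'
    have hN := planeNorm_sub_pos (hfpf (γ t))
    have hN' := planeNorm_sub_pos (fun h0 => hfpf (γ t) (Φ.injective h0))
    refine exists_int_of_polar_eq hN' (mul_pos hr hN) ?_
    rw [← e', hrt, e]
    push_cast
    rw [add_mul, Complex.exp_add]
    ring
  have hcont : ContinuousOn (fun t => θ' t - (D (γ t, h (γ t)) + θ t)) (Icc 0 1) :=
    hθ'.1.sub ((hD.comp (hγ.prodMk (h.continuous.comp_continuousOn hγ))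
      fun t _ => (hfpf (γ t)).symm).add hθ.1)
  have h0 : (0 : ℝ) ∈ Icc (0 : ℝ) 1 := ⟨le_rfl, zero_le_one⟩
  have h1 : (1 : ℝ) ∈ Icc (0 : ℝ) 1 := ⟨zero_le_one, le_rfl⟩
  have := isPreconnected_Icc.eq_of_sin_nonneg hcont (fun t ht => ?_) h0 h1 (hint 0 h0) (hint 1 h1)
  · simp only [hD0, hD1] at this
    linarith
  · obtain ⟨n, hn⟩ := hint t ht
    have := Real.sin_add_int_mul_two_pi 0 n
    rw [zero_add, Real.sin_zero] at this
    simp only [hn, this, le_refl]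
end

section
/- Vanishing of the index along a curve joining two points of the same orbit: let h be a Brouwer homeomorphism of the plane with h(ℤ₁) = ℤ₁, and suppose that h is isotopic relative to ℤ₁ to T or to T⁻¹. Then for every continuous curve γ : [0,1] → ℝ² with γ(0) ∈ ℤ₁ and γ(1) ∈ ℤ₁ and every angle function θ for h along γ, one has θ(1) = θ(0); that is, the index of h along any curve joining two points of ℤ₁ vanishes. -/
open Set

/-- A nowhere vanishing continuous function on a convex set has a continuous logarithm. -/
theorem exists_continuousOn_clog {E : Type*} [AddCommGroup E] [Module ℝ E] [TopologicalSpace E]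
    [IsTopologicalAddGroup E] [ContinuousSMul ℝ E] {S : Set E} (hS : Convex ℝ S) {f : E → ℂ}
    (hf : ContinuousOn f S) (hf0 : ∀ x ∈ S, f x ≠ 0) :
    ∃ φ : E → ℂ, ContinuousOn φ S ∧ ∀ x ∈ S, Complex.exp (φ x) = f x := by
  classical
  rcases S.eq_empty_or_nonempty with rfl | ⟨x₀, hx₀⟩
  · exact ⟨fun _ => 0, by simp, by simp⟩
  have hmem : ∀ (t : unitInterval) (x : S), x₀ + (t : ℝ) • ((x : E) - x₀) ∈ S := fun t x =>
    hS.add_smul_sub_mem hx₀ x.2 t.2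
  have hcont : Continuous fun q : unitInterval × S => f (x₀ + (q.1 : ℝ) • ((q.2 : E) - x₀)) :=
    hf.comp_continuous (by fun_prop) fun q => hmem q.1 q.2
  let H : C(unitInterval × S, {z : ℂ // z ≠ 0}) :=
    ⟨fun q => ⟨f (x₀ + (q.1 : ℝ) • ((q.2 : E) - x₀)), hf0 _ (hmem q.1 q.2)⟩,
      hcont.subtype_mk _⟩
  have H0 : ∀ a : S, H (0, a) = ⟨_, Complex.exp_ne_zero
      (ContinuousMap.const S (Complex.log (f x₀)) a)⟩ := fun a => by
    simp [H, Complex.exp_log (hf0 x₀ hx₀)]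
  let L := Complex.isCoveringMap_exp.liftHomotopy H _ H0
  refine ⟨fun x => if hx : x ∈ S then L (1, ⟨x, hx⟩) else 0, ?_, fun x hx => ?_⟩
  · rw [continuousOn_iff_continuous_domRestrict]
    have : S.domRestrict (fun x => if hx : x ∈ S then L (1, ⟨x, hx⟩) else 0)
        = fun x : S => L (1, x) := by
      ext x
      simp [Set.domRestrict]
    rw [this]
    fun_prop
  · have h1 := congr_fun (Complex.isCoveringMap_exp.liftHomotopy_lifts H _ H0) (1, ⟨x, hx⟩)
    simp only [dif_pos hx]
    exact (congrArg Subtype.val h1).trans (by simp [H])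

/-- Two continuous logarithms whose exponentials differ by a constant factor on a preconnected
set differ by an additive constant. -/
theorem sub_eq_sub_of_exp_eq_mul {X : Type*} [TopologicalSpace X] {S : Set X}
    (hS : IsPreconnected S) {φ ψ : X → ℂ} (hφ : ContinuousOn φ S) (hψ : ContinuousOn ψ S) {c : ℂ}
    (h : ∀ x ∈ S, Complex.exp (φ x) = c * Complex.exp (ψ x)) {x y : X} (hx : x ∈ S) (hy : y ∈ S) :
    φ x - ψ x = φ y - ψ y := by
  refine Complex.isCoveringMap_exp.constOn_of_comp hS (hφ.sub hψ) (fun a ha b hb => ?_) hx hy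
  have key : ∀ a ∈ S, Complex.exp (φ a - ψ a) = c := fun a ha => by
    rw [Complex.exp_sub, h a ha, mul_div_cancel_right₀ _ (Complex.exp_ne_zero _)]
  exact Subtype.ext ((key a ha).trans (key b hb).symm)

/-- Logarithms of the chords `δ s - δ r` of a curve satisfying `δ (t + 1) = h (δ t)`, transported
along an isotopy from `h` to a translation. -/
theorem exists_log_chords {h : ℂ → ℂ} {F : ℝ × ℂ → ℂ} {v : ℂ} (hF : Continuous F)
    (hFinj : ∀ t ∈ Icc (0 : ℝ) 1, Function.Injective fun z => F (t, z))
    (hF0 : ∀ z, F (0, z) = h z) (hF1 : ∀ z, F (1, z) = z + v)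
    {δ : ℝ → ℂ} (hδ : Continuous δ) (hδh : ∀ t, δ (t + 1) = h (δ t))
    {U : Set (ℝ × ℝ)} (hU : Convex ℝ U) (hU1 : ∀ p ∈ U, p + (1, 1) ∈ U)
    (hδU : ∀ p ∈ U, δ p.1 ≠ δ p.2) :
    ∃ (Φ : ℝ × (ℝ × ℝ) → ℂ) (K : ℂ), ContinuousOn Φ (Icc 0 1 ×ˢ U) ∧
      (∀ t ∈ Icc (0 : ℝ) 1, ∀ p ∈ U,
        Complex.exp (Φ (t, p)) = F (t, δ p.2) - F (t, δ p.1)) ∧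
      ∀ p ∈ U, Φ (1, p + (1, 1)) = Φ (0, p) + K := by
  obtain ⟨Φ, hΦ, hexp⟩ := exists_continuousOn_clog ((convex_Icc (0 : ℝ) 1).prod hU)
    (f := fun q : ℝ × (ℝ × ℝ) => F (q.1, δ q.2.2) - F (q.1, δ q.2.1))
    (by fun_prop) (fun q hq h0 => hδU q.2 hq.2 (hFinj q.1 hq.1 (sub_eq_zero.1 h0)).symm)
  have hexp' : ∀ t ∈ Icc (0 : ℝ) 1, ∀ p ∈ U,
      Complex.exp (Φ (t, p)) = F (t, δ p.2) - F (t, δ p.1) := fun t ht p hp => hexp (t, p) ⟨ht, hp⟩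
  rcases U.eq_empty_or_nonempty with rfl | ⟨p₀, hp₀⟩
  · exact ⟨Φ, 0, hΦ, hexp', by simp⟩
  refine ⟨Φ, Φ (1, p₀ + (1, 1)) - Φ (0, p₀), hΦ, hexp', fun p hp => ?_⟩
  have h1 : ContinuousOn (fun p => Φ (1, p + (1, 1))) U :=
    hΦ.comp (by fun_prop) fun p hp => ⟨by simp, hU1 p hp⟩
  have h0 : ContinuousOn (fun p => Φ (0, p)) U :=
    hΦ.comp (by fun_prop) fun p hp => ⟨by simp, hp⟩
  have := sub_eq_sub_of_exp_eq_mul hU.isPreconnected h1 h0 (c := 1) (fun p hp => by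
    rw [hexp' 1 (by simp) _ (hU1 p hp), hexp' 0 (by simp) p hp, hF0, hF0, hF1, hF1]
    simp [hδh]) hp hp₀
  rw [← this]
  ring

/-- A curve `δ` with `δ (t + 1) = h (δ t)`, where `h` is fixed point free and isotopic to a
translation, has no shortest self-intersection `δ 0 = δ L` with `L > 1`. -/
theorem no_shortest_self_intersection {h : ℂ → ℂ} (hh : Continuous h) (hfix : ∀ z, h z ≠ z)
    {F : ℝ × ℂ → ℂ} {v : ℂ} (hF : Continuous F)
    (hFinj : ∀ t ∈ Icc (0 : ℝ) 1, Function.Injective fun z => F (t, z))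
    (hF0 : ∀ z, F (0, z) = h z) (hF1 : ∀ z, F (1, z) = z + v)
    {δ : ℝ → ℂ} (hδ : Continuous δ) (hδh : ∀ t, δ (t + 1) = h (δ t)) {L : ℝ} (hL : 1 < L)
    (hδU : ∀ r s, r < s → s < r + L → δ r ≠ δ s) : δ 0 ≠ δ L := by
  intro hδL
  set U : Set (ℝ × ℝ) := {p | p.1 < p.2 ∧ p.2 < p.1 + L} with hUdef
  have hU : Convex ℝ U := by
    rintro ⟨a, b⟩ ⟨h1, h2⟩ ⟨c, d⟩ ⟨h3, h4⟩ x y hx hy hxy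
    simp only at h1 h2 h3 h4
    obtain rfl : y = 1 - x := by linarith
    simp only [hUdef, mem_ofPred_eq, Prod.smul_mk, Prod.mk_add_mk, smul_eq_mul]
    rcases hx.eq_or_lt with rfl | hx
    · constructor <;> linarith
    · constructor <;> nlinarith
  obtain ⟨Φ, K, hΦ, hexp, hK⟩ := exists_log_chords hF hFinj hF0 hF1 hδ hδh hU
    (fun p hp => by simpa [hUdef, add_right_comm] using hp) (fun p hp => hδU _ _ hp.1 hp.2)
  obtain ⟨θ, hθ, hθexp⟩ := exists_continuousOn_clog (convex_univ (𝕜 := ℝ) (E := ℂ))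
    (f := fun z => h z - z) (by fun_prop) (fun z _ => sub_ne_zero.2 (hfix z))
  -- comparison of the two families of chords with endpoint `δ 0 = δ L`
  have hc : ∀ q ∈ Icc (0 : ℝ) 1 ×ˢ Ioo 0 L, ∀ q' ∈ Icc (0 : ℝ) 1 ×ˢ Ioo 0 L,
      Φ (q.1, (q.2, L)) - Φ (q.1, (0, q.2)) = Φ (q'.1, (q'.2, L)) - Φ (q'.1, (0, q'.2)) := by
    intro q hq q' hq'
    have hm1 : ∀ q ∈ Icc (0 : ℝ) 1 ×ˢ Ioo 0 L, (q.2, L) ∈ U := fun q hq => by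
      have := hq.2.1; have := hq.2.2
      constructor <;> simp only <;> linarith
    have hm0 : ∀ q ∈ Icc (0 : ℝ) 1 ×ˢ Ioo 0 L, ((0 : ℝ), q.2) ∈ U := fun q hq => by
      have := hq.2.1; have := hq.2.2
      constructor <;> simp only <;> linarith
    refine sub_eq_sub_of_exp_eq_mul (φ := fun q : ℝ × ℝ => Φ (q.1, (q.2, L)))
      (ψ := fun q : ℝ × ℝ => Φ (q.1, (0, q.2)))
      ((convex_Icc (0 : ℝ) 1).prod (convex_Ioo 0 L)).isPreconnected
      (hΦ.comp (by fun_prop) fun q hq => ⟨hq.1, hm1 q hq⟩)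
      (hΦ.comp (by fun_prop) fun q hq => ⟨hq.1, hm0 q hq⟩) (c := -1) (fun q hq => ?_) hq hq'
    rw [hexp _ hq.1 _ (hm1 q hq), hexp _ hq.1 _ (hm0 q hq), hδL]
    ring
  have h1 := hc (1, 1) ⟨by simp, by simp, hL⟩ (0, L - 1)
    ⟨by simp, by simpa using hL, by simp⟩
  have hKL := hK (L - 1, L) ⟨by simp, by simp only; linarith⟩
  have hK0 := hK (0, L - 1) ⟨by simpa using hL, by simp⟩
  simp only [Prod.mk_add_mk, sub_add_cancel, zero_add] at h1 hKL hK0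
  have hm : ∀ t : ℝ, (t, t + 1) ∈ U := fun t => ⟨by simp, by simpa using hL⟩
  have h2 := sub_eq_sub_of_exp_eq_mul isPreconnected_univ (φ := fun t : ℝ => Φ (1, (t, t + 1)))
    (ψ := fun t => θ (δ t)) (hΦ.comp (by fun_prop) fun t _ => ⟨by simp, hm t⟩)
    (hθ.comp hδ.continuousOn fun _ _ => mem_univ _) (c := 1) (fun t _ => by
      rw [hexp 1 (by simp) _ (hm t), hθexp _ (mem_univ _), hF1, hF1, hδh]; ring)
    (mem_univ 0) (mem_univ L)
  simp only [hδL, zero_add] at h2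
  have h3 : Φ (1, (1, L)) = Φ (1, (0, 1)) := by linear_combination (h1 - hKL + hK0 - h2) / 2
  have h4 := hexp 1 (by simp) (1, L) ⟨hL, by simp⟩
  rw [h3, hexp 1 (by simp) (0, 1) ⟨by simp, by simpa using hL⟩] at h4
  simp only [hF1, hδL] at h4
  exact hδU 1 L hL (by simp) (by linear_combination h4 / 2)

/-- A curve from `β 0` to `h (β 0)` extends to a curve on the whole line that conjugates `h` to the
unit translation. -/
theorem exists_equivariant_curve {X : Type*} [TopologicalSpace X] (h : X ≃ₜ X) {β : ℝ → X}
    (hβ : Continuous β) (hβ1 : β 1 = h (β 0)) :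
    ∃ δ : ℝ → X, Continuous δ ∧ (∀ t, δ (t + 1) = h (δ t)) ∧ ∀ t ∈ Icc (0 : ℝ) 1, δ t = β t := by
  have key : ∀ (n : ℤ), ∀ t ∈ Icc (n : ℝ) (n + 1),
      (h ^ ⌊t⌋) (β (Int.fract t)) = (h ^ n) (β (t - n)) := by
    intro n t ht
    rcases ht.2.eq_or_lt with rfl | hlt
    · have : ⌊(n : ℝ) + 1⌋ = n + 1 := by simp
      simp [this, zpow_add_one, hβ1]
    · have : ⌊t⌋ = n := Int.floor_eq_iff.2 ⟨ht.1, hlt⟩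
      simp [this, Int.fract]
  refine ⟨fun t => (h ^ ⌊t⌋) (β (Int.fract t)), ?_, fun t => ?_, fun t ht => ?_⟩
  · refine LocallyFinite.continuous (f := fun n : ℤ => Icc (n : ℝ) (n + 1)) ?_ ?_
      (fun n => isClosed_Icc) fun n => ?_
    · intro x
      refine ⟨Ioo (x - 1) (x + 1), Ioo_mem_nhds (by simp) (by simp),
        (Set.finite_Icc (⌊x⌋ - 2) (⌊x⌋ + 2)).subset ?_⟩
      rintro n ⟨y, hy, hy'⟩
      have h1 := Int.floor_le x
      have h2 := Int.lt_floor_add_one x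
      have h3 : (n : ℝ) < ((⌊x⌋ + 2 : ℤ) : ℝ) := by push_cast; linarith [hy.1, hy'.2]
      have h4 : ((⌊x⌋ - 2 : ℤ) : ℝ) < n := by push_cast; linarith [hy.2, hy'.1]
      exact ⟨(Int.cast_lt.1 h4).le, (Int.cast_lt.1 h3).le⟩
    · exact eq_univ_of_forall fun t => mem_iUnion.2
        ⟨⌊t⌋, Int.floor_le t, (Int.lt_floor_add_one t).le⟩
    · exact ((h ^ n).continuous.comp (hβ.comp (by fun_prop : Continuous fun t : ℝ => t - n))
        ).continuousOn.congr (key n)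
  · simp [add_comm _ (1 : ℤ), zpow_one_add]
  · simpa using key 0 t (by simpa using ht)

theorem equivariant_curve_add_int {X : Type*} [TopologicalSpace X] {h : X ≃ₜ X} {δ : ℝ → X}
    (hδh : ∀ t, δ (t + 1) = h (δ t)) (t : ℝ) (n : ℤ) : δ (t + n) = (h ^ n) (δ t) := by
  induction n using Int.induction_on with
  | zero => simp
  | succ n ih =>
    rw [add_comm (n : ℤ) 1, zpow_one_add, Homeomorph.mul_apply, ← ih, ← hδh]
    push_cast
    ring_nf
  | pred n ih =>
    apply h.injective
    rw [← hδh, ← Homeomorph.mul_apply, ← zpow_one_add, add_sub_cancel, ← ih]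
    push_cast
    ring_nf

theorem equivariant_curve_add_int_inj {X : Type*} [TopologicalSpace X] {h : X ≃ₜ X} {δ : ℝ → X}
    (hδh : ∀ t, δ (t + 1) = h (δ t)) {r s : ℝ} (n : ℤ) :
    δ (r + n) = δ (s + n) ↔ δ r = δ s := by
  rw [equivariant_curve_add_int hδh, equivariant_curve_add_int hδh, (h ^ n).injective.eq_iff]

/-- A closed disc around `x₀` that meets its image under `h` only along boundaries, and does
meet it. -/
theorem exists_critical_disc (h : ℂ ≃ₜ ℂ) (hfix : ∀ z, h z ≠ z) (x₀ : ℂ) :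
    ∃ (ρ : ℝ) (w : ℂ), 0 < ρ ∧ ‖w - x₀‖ = ρ ∧ ‖h w - x₀‖ = ρ ∧
      ∀ u, ‖u - x₀‖ ≤ ρ → ‖h u - x₀‖ ≤ ρ → ‖u - x₀‖ = ρ ∧ ‖h u - x₀‖ = ρ := by
  have htend : Filter.Tendsto (fun u => max ‖u - x₀‖ ‖h u - x₀‖) (Filter.cocompact ℂ)
      Filter.atTop := by
    refine Filter.tendsto_atTop_mono (fun u => le_max_left _ _) ?_
    have := tendsto_dist_right_cocompact_atTop x₀
    simpa [dist_eq_norm] using this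
  have hc := h.continuous
  obtain ⟨w, hw⟩ := (show Continuous fun u => max ‖u - x₀‖ ‖h u - x₀‖ by fun_prop
    ).exists_forall_le htend
  set ρ := max ‖w - x₀‖ ‖h w - x₀‖ with hρ
  have hρ0 : 0 < ρ := by
    rcases (norm_nonneg (w - x₀)).lt_or_eq with h0 | h0
    · exact lt_max_of_lt_left h0
    · rcases (norm_nonneg (h w - x₀)).lt_or_eq with h1 | h1
      · exact lt_max_of_lt_right h1
      · exact absurd ((sub_eq_zero.1 (norm_eq_zero.1 h1.symm)).trans
          (sub_eq_zero.1 (norm_eq_zero.1 h0.symm)).symm) (hfix w)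
  have hcl : closure (Metric.ball x₀ ρ) = Metric.closedBall x₀ ρ := closure_ball _ hρ0.ne'
  have main : ∀ u, ‖u - x₀‖ ≤ ρ → ‖h u - x₀‖ ≤ ρ → ‖u - x₀‖ = ρ ∧ ‖h u - x₀‖ = ρ := by
    intro u h1 h2
    constructor
    · by_contra hne
      have hlt : ‖h.symm (h u) - x₀‖ < ρ := by simpa using lt_of_le_of_ne h1 hne
      have hmem : h u ∈ closure (Metric.ball x₀ ρ) := by
        rw [hcl, mem_closedBall_iff_norm]; exact h2
      have hc' := h.symm.continuous
      obtain ⟨y, hy1, hy2⟩ := mem_closure_iff.1 hmem {y | ‖h.symm y - x₀‖ < ρ}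
        (isOpen_lt (by fun_prop) continuous_const) hlt
      have := hw (h.symm y)
      rw [h.apply_symm_apply] at this
      exact this.not_gt (max_lt hy1 (mem_ball_iff_norm.1 hy2))
    · by_contra hne
      have hlt : ‖h u - x₀‖ < ρ := lt_of_le_of_ne h2 hne
      have hmem : u ∈ closure (Metric.ball x₀ ρ) := by
        rw [hcl, mem_closedBall_iff_norm]; exact h1
      obtain ⟨y, hy1, hy2⟩ := mem_closure_iff.1 hmem {y | ‖h y - x₀‖ < ρ}
        (isOpen_lt (by fun_prop) continuous_const) hlt
      exact (hw y).not_gt (max_lt (mem_ball_iff_norm.1 hy2) hy1)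
  obtain ⟨e1, e2⟩ := main w (le_max_left _ _) (le_max_right _ _)
  exact ⟨ρ, w, hρ0, e1, e2, main⟩

/-- Through every point passes the union of the iterates of a translation arc. -/
theorem exists_translation_curve (h : ℂ ≃ₜ ℂ) (hfix : ∀ z, h z ≠ z) (x₀ : ℂ) :
    ∃ δ : ℝ → ℂ, Continuous δ ∧ (∀ t, δ (t + 1) = h (δ t)) ∧ δ 0 = x₀ ∧
      ∀ r s, r < s → s ≤ r + 1 → δ r ≠ δ s := by
  obtain ⟨ρ, w, hρ, hw, hhw, hfree⟩ := exists_critical_disc h hfix x₀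
  set β : ℝ → ℂ := fun t =>
    x₀ + (max (1 - 2 * t) 0 : ℝ) * (w - x₀) + (max (2 * t - 1) 0 : ℝ) * (h w - x₀) with hβdef
  have hβl : ∀ t ≤ 1 / 2, β t = x₀ + (1 - 2 * t : ℝ) * (w - x₀) := fun t ht => by
    simp only [hβdef]
    rw [max_eq_left (by linarith), max_eq_right (by linarith)]
    simp
  have hβr : ∀ t ≥ 1 / 2, β t = x₀ + (2 * t - 1 : ℝ) * (h w - x₀) := fun t ht => by
    simp only [hβdef]
    rw [max_eq_right (by linarith), max_eq_left (by linarith)]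
    simp
  have hnorm : ∀ t, ‖β t - x₀‖ = |1 - 2 * t| * ρ := by
    intro t
    rcases le_total t (1 / 2) with ht | ht
    · rw [hβl t ht, add_sub_cancel_left, norm_mul, hw, Complex.norm_real, Real.norm_eq_abs]
    · rw [hβr t ht, add_sub_cancel_left, norm_mul, hhw, Complex.norm_real, Real.norm_eq_abs,
        abs_sub_comm]
  have hinj : ∀ a b, a < b → β a ≠ β b := by
    intro a b hab heq
    have h1 : |1 - 2 * a| = |1 - 2 * b| := by
      refine mul_right_cancel₀ hρ.ne' ?_
      rw [← hnorm, ← hnorm, heq]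
    have h2 : 1 - 2 * a = -(1 - 2 * b) := by
      rcases abs_eq_abs.1 h1 with h2 | h2
      · linarith
      · exact h2
    rw [hβl a (by linarith), hβr b (by linarith), h2, neg_sub] at heq
    have h3 : ((2 * b - 1 : ℝ) : ℂ) ≠ 0 := by
      rw [Complex.ofReal_ne_zero]
      intro h0
      linarith
    exact hfix w (sub_left_injective (mul_left_cancel₀ h3 (add_left_cancel heq))).symm
  obtain ⟨δ, hδ, hδh, hδβ⟩ := exists_equivariant_curve h (β := β) (by fun_prop) (by
    rw [hβl 0 (by norm_num), hβr 1 (by norm_num)]; norm_num)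
  have hshort : ∀ r s, r < s → s ≤ r + 1 → δ r ≠ δ s := by
    intro r s hrs hsr heq
    have heq' := (equivariant_curve_add_int_inj hδh (-⌊r⌋)).2 heq
    push_cast at heq'
    rw [← sub_eq_add_neg, ← sub_eq_add_neg] at heq'
    have hr0 := Int.floor_le r
    have hr1 := Int.lt_floor_add_one r
    generalize hr' : r - ⌊r⌋ = r' at heq'
    generalize hs' : s - ⌊r⌋ = s' at heq'
    rw [hδβ r' ⟨by linarith, by linarith⟩] at heq'
    rcases le_or_gt s' 1 with hs1 | hs1
    · rw [hδβ s' ⟨by linarith, hs1⟩] at heq'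
      exact hinj r' s' (by linarith) heq'
    · have hs2 : δ s' = h (β (s' - 1)) := by
        rw [← hδβ (s' - 1) ⟨by linarith, by linarith⟩, ← hδh, sub_add_cancel]
      rw [hs2] at heq'
      have hle : ∀ t ∈ Icc (0 : ℝ) 1, ‖β t - x₀‖ ≤ ρ := fun t ht => by
        rw [hnorm]
        refine mul_le_of_le_one_left hρ.le (abs_le.2 ⟨?_, ?_⟩) <;> linarith [ht.1, ht.2]
      have h1 := (hfree (β (s' - 1)) (hle _ ⟨by linarith, by linarith⟩)
        (heq' ▸ hle r' ⟨by linarith, by linarith⟩)).1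
      rw [hnorm, mul_eq_right₀ hρ.ne'] at h1
      rcases (abs_eq zero_le_one).1 h1 with h2 | h2 <;> linarith
  refine ⟨fun t => δ (t + 1 / 2), by fun_prop, fun t => ?_, ?_, fun r s hrs hsr =>
    hshort _ _ (by linarith) (by linarith)⟩
  · simp only [add_right_comm t 1, hδh]
  · simp only [zero_add]
    rw [hδβ _ ⟨by norm_num, by norm_num⟩, hβl _ le_rfl]
    norm_num

/-- Brouwer's lemma on translation arcs, for a fixed point free homeomorphism isotopic to a
translation. -/
theorem translation_curve_injective {h : ℂ ≃ₜ ℂ} (hfix : ∀ z, h z ≠ z)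
    {F : ℝ × ℂ → ℂ} {v : ℂ} (hF : Continuous F)
    (hFinj : ∀ t ∈ Icc (0 : ℝ) 1, Function.Injective fun z => F (t, z))
    (hF0 : ∀ z, F (0, z) = h z) (hF1 : ∀ z, F (1, z) = z + v)
    {δ : ℝ → ℂ} (hδ : Continuous δ) (hδh : ∀ t, δ (t + 1) = h (δ t))
    (hshort : ∀ r s, r < s → s ≤ r + 1 → δ r ≠ δ s) {r s : ℝ} (hrs : r < s) : δ r ≠ δ s := by
  intro heq
  have hfloor : ∀ {r s : ℝ}, δ r = δ s → δ (Int.fract r) = δ (Int.fract r + (s - r)) := by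
    intro r s heq
    have := (equivariant_curve_add_int_inj hδh (-⌊r⌋)).2 heq
    push_cast at this
    rw [← sub_eq_add_neg, ← sub_eq_add_neg] at this
    rw [Int.fract, this]
    ring_nf
  have hlong : 1 < s - r := by
    by_contra hle
    exact hshort r s hrs (by linarith) heq
  set Z : Set (ℝ × ℝ) := (Icc 0 1 ×ˢ Icc 1 (s - r)) ∩ {q | δ q.1 = δ (q.1 + q.2)} with hZ
  have hZc : IsCompact Z := (isCompact_Icc.prod isCompact_Icc).inter_right
    (isClosed_eq (by fun_prop) (by fun_prop))
  have hZn : Z.Nonempty := ⟨(Int.fract r, s - r),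
    ⟨⟨Int.fract_nonneg r, (Int.fract_lt_one r).le⟩, hlong.le, le_rfl⟩, hfloor heq⟩
  obtain ⟨⟨r₀, L⟩, ⟨⟨hr₀, hL⟩, hr₀L⟩, hmin⟩ := hZc.exists_isMinOn hZn continuous_snd.continuousOn
  simp only [mem_ofPred_eq] at hr₀ hL hr₀L
  have hL1 : 1 < L := by
    refine lt_of_le_of_ne hL.1 ?_
    rintro rfl
    exact hshort r₀ (r₀ + 1) (by simp) le_rfl hr₀L
  have hno : ∀ a b, a < b → b < a + L → δ a ≠ δ b := by
    intro a b hab hba heq'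
    rcases le_or_gt b (a + 1) with hb | hb
    · exact hshort a b hab hb heq'
    · have : L ≤ b - a := hmin (a := (Int.fract a, b - a))
        ⟨⟨⟨Int.fract_nonneg a, (Int.fract_lt_one a).le⟩, by simp only; linarith,
          by simp only; linarith [hL.2]⟩, hfloor heq'⟩
      linarith
  refine no_shortest_self_intersection h.continuous hfix hF hFinj hF0 hF1
    (δ := fun t => δ (t + r₀)) (by fun_prop) (fun t => ?_) hL1
    (fun a b hab hba => hno _ _ (by linarith) (by linarith)) ?_
  · simp only [add_right_comm t 1, hδh]
  · simpa [add_comm] using hr₀L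

/-- If `h` is isotopic to the translation by `v` relative to the points `c + k v`, then a
logarithm of the displacement `h z - z` takes the same value at `c` and `c + v`. -/
theorem log_displacement_add_eq {h : ℂ ≃ₜ ℂ} (hfix : ∀ z, h z ≠ z)
    {F : ℝ × ℂ → ℂ} {v c : ℂ} (hv : v ≠ 0) (hF : Continuous F)
    (hFinj : ∀ t ∈ Icc (0 : ℝ) 1, Function.Injective fun z => F (t, z))
    (hF0 : ∀ z, F (0, z) = h z) (hF1 : ∀ z, F (1, z) = z + v)
    (hFc : ∀ t ∈ Icc (0 : ℝ) 1, ∀ k : ℤ, F (t, c + k * v) = c + (k + 1) * v)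
    {θ : ℂ → ℂ} (hθ : Continuous θ) (hθexp : ∀ z, Complex.exp (θ z) = h z - z) :
    θ (c + v) = θ c := by
  obtain ⟨δ, hδ, hδh, hδ0, hshort⟩ := exists_translation_curve h hfix c
  have hinj : ∀ p ∈ {p : ℝ × ℝ | p.1 < p.2}, δ p.1 ≠ δ p.2 := fun p hp =>
    translation_curve_injective hfix hF hFinj hF0 hF1 hδ hδh hshort hp
  have hstep : ∀ k : ℤ, h (c + k * v) = c + (k + 1) * v := fun k => by
    rw [← hF0, hFc 0 (by simp)]
  have hδk : ∀ k : ℤ, δ k = c + k * v := by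
    intro k
    induction k using Int.induction_on with
    | zero => simp [hδ0]
    | succ n ih =>
      push_cast at ih ⊢
      rw [hδh, ih]
      simpa using hstep n
    | pred n ih =>
      apply h.injective
      rw [hstep, ← hδh]
      push_cast at ih ⊢
      rw [sub_add_cancel, sub_add_cancel, ih]
  have hU : Convex ℝ {p : ℝ × ℝ | p.1 < p.2} := by
    have := (convex_Ioi (0 : ℝ)).linear_preimage (LinearMap.snd ℝ ℝ ℝ - LinearMap.fst ℝ ℝ ℝ)
    simpa [preimage, sub_pos] using this
  obtain ⟨Φ, K, hΦ, hexp, hK⟩ := exists_log_chords hF hFinj hF0 hF1 hδ hδh hU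
    (fun p hp => by
      simpa only [mem_ofPred_eq, Prod.fst_add, Prod.snd_add, add_lt_add_iff_right] using hp) hinj
  have h1mem : (1 : ℝ) ∈ Icc (0 : ℝ) 1 := by simp
  have hexp1 : ∀ r s, r < s → Complex.exp (Φ (1, (r, s))) = δ s - δ r := fun r s hrs => by
    rw [hexp 1 h1mem (r, s) hrs, hF1, hF1]
    ring
  have hshift : ∀ i j : ℤ, i < j →
      Φ (1, ((i + 1 : ℝ), (j + 1 : ℝ))) = Φ (1, ((i : ℝ), (j : ℝ))) + K := by
    intro i j hij
    have hm : ((i : ℝ), (j : ℝ)) ∈ {p : ℝ × ℝ | p.1 < p.2} := by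
      simpa using hij
    have h1 := hK _ hm
    have h2 := sub_eq_sub_of_exp_eq_mul (isPreconnected_Icc (a := (0 : ℝ)) (b := 1))
      (φ := fun t => Φ (t, ((i : ℝ), (j : ℝ)))) (ψ := fun _ => 0)
      (hΦ.comp (by fun_prop) fun t ht => ⟨ht, hm⟩) continuousOn_const (c := (j - i) * v)
      (fun t ht => by
        rw [hexp t ht _ hm]
        simp only [hδk, hFc t ht, Complex.exp_zero]
        ring) h1mem (by simp : (0 : ℝ) ∈ _)
    simp only [sub_zero] at h2
    simp only [Prod.mk_add_mk] at h1
    rw [h1, h2]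
  have hshiftn : ∀ (n : ℕ) (i j : ℤ), i < j →
      Φ (1, ((i + n : ℝ), (j + n : ℝ))) = Φ (1, ((i : ℝ), (j : ℝ))) + n * K := by
    intro n i j hij
    induction n with
    | zero => simp
    | succ n ih =>
      have := hshift (i + n) (j + n) (by linarith)
      push_cast at this ⊢
      rw [← add_assoc, ← add_assoc, this, ih]
      ring
  -- the chords from the arc `δ '' [0, 1]` to a far point of the orbit
  obtain ⟨R, hR⟩ := (isCompact_Icc (a := (0 : ℝ)) (b := 1)).exists_bound_of_continuousOn
    (f := fun t => (δ t - c) / v) (by fun_prop)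
  obtain ⟨N, hN⟩ := exists_nat_gt (max R 1)
  have hRN : R < N := (le_max_left _ _).trans_lt hN
  have h1N : (1 : ℝ) < N := (le_max_right _ _).trans_lt hN
  have hslit : ∀ t ∈ Icc (0 : ℝ) 1, ∀ n : ℕ, N ≤ n →
      (n : ℂ) + (δ t - c) / v ∈ Complex.slitPlane ∧
      (n : ℂ) - (δ t - c) / v ∈ Complex.slitPlane := by
    intro t ht n hn
    have h1 := (abs_le.1 ((Complex.abs_re_le_norm _).trans (hR t ht)))
    have h2 : (N : ℝ) ≤ n := Nat.cast_le.2 hn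
    constructor <;> left <;> simp only [Complex.add_re, Complex.sub_re, Complex.natCast_re] <;>
      linarith [h1.1, h1.2]
  have hδ1' : δ 1 = c + v := by simpa using hδk 1
  have hfar : Φ (1, (1, ((N + 1 : ℕ) : ℝ))) - Complex.log N =
      Φ (1, (0, ((N + 1 : ℕ) : ℝ))) - Complex.log (N + 1) := by
    have hm : ∀ r ∈ Icc (0 : ℝ) 1, r < ((N + 1 : ℕ) : ℝ) := fun r hr => by
      push_cast
      linarith [hr.2]
    have := sub_eq_sub_of_exp_eq_mul (isPreconnected_Icc (a := (0 : ℝ)) (b := 1))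
      (φ := fun r => Φ (1, (r, ((N + 1 : ℕ) : ℝ))))
      (ψ := fun r => Complex.log (((N + 1 : ℕ) : ℂ) - (δ r - c) / v))
      (hΦ.comp (by fun_prop) fun r hr => ⟨h1mem, hm r hr⟩)
      (ContinuousOn.clog (by fun_prop) fun r hr => (hslit r hr _ (by simp)).2) (c := v)
      (fun r hr => by
        rw [hexp1 _ _ (hm r hr),
          Complex.exp_log (Complex.slitPlane_ne_zero (hslit r hr _ (by simp)).2)]
        have := hδk (N + 1 : ℕ)
        rw [Int.cast_natCast] at this
        rw [this]
        field_simp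
        push_cast
        ring) h1mem (by simp : (0 : ℝ) ∈ _)
    simpa [hδ0, hδ1', hv] using this
  have hfar' : Φ (1, (((-N : ℤ) : ℝ), 1)) - Complex.log (N + 1) =
      Φ (1, (((-N : ℤ) : ℝ), 0)) - Complex.log N := by
    have hm : ∀ s ∈ Icc (0 : ℝ) 1, ((-N : ℤ) : ℝ) < s := fun s hs => by
      push_cast
      linarith [hs.1]
    have := sub_eq_sub_of_exp_eq_mul (isPreconnected_Icc (a := (0 : ℝ)) (b := 1))
      (φ := fun s => Φ (1, (((-N : ℤ) : ℝ), s)))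
      (ψ := fun s => Complex.log ((N : ℂ) + (δ s - c) / v))
      (hΦ.comp (by fun_prop) fun s hs => ⟨h1mem, hm s hs⟩)
      (ContinuousOn.clog (by fun_prop) fun s hs => (hslit s hs _ le_rfl).1) (c := v)
      (fun s hs => by
        rw [hexp1 _ _ (hm s hs),
          Complex.exp_log (Complex.slitPlane_ne_zero (hslit s hs _ le_rfl).1), hδk]
        field_simp
        push_cast
        ring) h1mem (by simp : (0 : ℝ) ∈ _)
    simpa [hδ0, hδ1', hv] using this
  have e3 := hshiftn N (-N) 1 (by linarith)
  have e4 := hshiftn N (-N) 0 (by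
    have : 1 < N := by exact_mod_cast h1N
    omega)
  have e5 := hshift 0 N (by
    have : 1 < N := by exact_mod_cast h1N
    omega)
  have e6 := hshift 0 1 (by norm_num)
  push_cast at e3 e4 e5 e6 hfar hfar'
  simp only [neg_add_cancel, zero_add, add_comm (1 : ℝ) (N : ℝ)] at e3 e4 e5 e6
  have hK0 : K = 0 := by linear_combination -e5 + hfar + e3 + hfar' - e4
  have h2 := sub_eq_sub_of_exp_eq_mul isPreconnected_univ (φ := fun t : ℝ => Φ (1, (t, t + 1)))
    (ψ := fun t => θ (δ t)) (hΦ.comp (by fun_prop) fun t _ => ⟨by simp, by simp⟩)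
    (hθ.comp hδ).continuousOn (c := 1) (fun t _ => by
      rw [hexp1 _ _ (by simp), hθexp, hδh]; ring)
    (mem_univ 0) (mem_univ 1)
  simp only [hδ0, hδ1', zero_add] at h2
  linear_combination e6 + hK0 + h2

/-- The identification of `ℂ` with the plane. -/
noncomputable def complexPlane : ℂ ≃ₜ Plane := Complex.equivRealProdCLM.toHomeomorph

theorem norm_complexPlane_symm (p : Plane) : ‖complexPlane.symm p‖ = planeNorm p := by
  simp [complexPlane, planeNorm, Complex.norm_eq_sqrt_sq_add_sq]

theorem complexPlane_symm_apply (p : Plane) :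
    complexPlane.symm p = (p.1 : ℂ) + p.2 * Complex.I := by
  simp [complexPlane, Complex.equivRealProdCLM_symm_apply]

/-- Vanishing of the index between points of `ℤ₁` for a fixed point free homeomorphism isotopic
to a unit horizontal translation relative to `ℤ₁`. -/
theorem index_vanishes_of_isotopy_to_translation (h : Plane ≃ₜ Plane) (hfix : ∀ x, h x ≠ x)
    {g : Plane → Plane} {ε : ℤ} (hε : ε = 1 ∨ ε = -1) (hg : ∀ x, g x = (x.1 + ε, x.2))
    (hiso : IsotopicRel h g Z1)
    {γ : ℝ → Plane} (hγ : ContinuousOn γ (Icc 0 1)) (hγ0 : γ 0 ∈ Z1) (hγ1 : γ 1 ∈ Z1)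
    {θ : ℝ → ℝ} (hθ : IsAngleFunction h γ θ) :
    θ 1 = θ 0 := by
  obtain ⟨F, hF, hFhomeo, hF0, hF1, hFZ⟩ := hiso
  set e := complexPlane
  have hec := e.continuous
  have hec' := e.symm.continuous
  set H : ℂ ≃ₜ ℂ := e.trans (h.trans e.symm)
  have hHfix : ∀ z, H z ≠ z := fun z hz => hfix (e z) (by
    simpa [H] using congrArg e hz)
  obtain ⟨Θ, hΘ, hΘexp⟩ := exists_continuousOn_clog (convex_univ (𝕜 := ℝ) (E := ℂ))
    (f := fun z => H z - z) (H.continuous.sub continuous_id).continuousOn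
    (fun z _ => sub_ne_zero.2 (hHfix z))
  rw [continuousOn_univ] at hΘ
  have hstep : ∀ n : ℤ, Θ (((n + ε : ℤ) : ℂ) + Complex.I) = Θ (n + Complex.I) := by
    intro n
    have := log_displacement_add_eq (h := H) hHfix (F := fun q => e.symm (F (q.1, e q.2)))
      (v := ε) (c := n + Complex.I) (by rcases hε with rfl | rfl <;> simp) (by fun_prop)
      (fun t ht a b hab => by
        obtain ⟨f, hf⟩ := hFhomeo t ht
        simp only [← hf] at hab
        exact e.injective (f.injective (e.symm.injective hab)))
      (fun z => by simp [H, hF0])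
      (fun z => by
        simp only [hF1, hg]
        apply e.injective
        simp [e, complexPlane])
      (fun t ht k => by
        have hz : e (n + Complex.I + k * ε) = (((n + k * ε : ℤ) : ℝ), 1) := by
          simp [e, complexPlane]
        rw [hz, hFZ t ht _ ⟨_, rfl⟩, ← hFZ 1 (by simp) _ ⟨_, rfl⟩, hF1, hg,
          complexPlane_symm_apply]
        push_cast
        ring) hΘ (fun z => hΘexp z (mem_univ z))
    rw [← this]
    push_cast
    ring_nf
  have hsucc : ∀ n : ℤ, Θ (((n + 1 : ℤ) : ℂ) + Complex.I) = Θ (n + Complex.I) := by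
    intro n
    rcases hε with rfl | rfl
    · exact hstep n
    · have := hstep (n + 1)
      rw [add_neg_cancel_right] at this
      exact this.symm
  have hconst : ∀ n : ℤ, Θ (n + Complex.I) = Θ Complex.I := by
    intro n
    induction n using Int.induction_on with
    | zero => simp
    | succ n ih => rw [hsucc, ih]
    | pred n ih =>
      have := hsucc (-n - 1)
      rw [sub_add_cancel, ih] at this
      exact this.symm
  have hZ : ∀ p ∈ Z1, Θ (e.symm p) = Θ Complex.I := by
    rintro p ⟨n, rfl⟩
    rw [complexPlane_symm_apply, ← hconst n]
    simp
  have hangle : ∀ t ∈ Icc (0 : ℝ) 1, Complex.exp ((Θ (e.symm (γ t))).im * Complex.I)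
      = 1 * Complex.exp (θ t * Complex.I) := by
    intro t ht
    set w := Θ (e.symm (γ t)) with hw
    have h1 : Complex.exp w = e.symm (h (γ t) - γ t) := by
      rw [hΘexp _ (mem_univ _)]
      simp only [H, Homeomorph.trans_apply, Homeomorph.apply_symm_apply]
      simp only [e, complexPlane_symm_apply]
      simp
      ring
    have h2 : Real.exp w.re = planeNorm (h (γ t) - γ t) := by
      rw [← Complex.norm_exp, h1, norm_complexPlane_symm]
    rw [hθ.2 t ht, complexPlane_symm_apply, ← h2, ← Complex.re_add_im w, Complex.exp_add] at h1
    refine mul_left_cancel₀ (Complex.exp_ne_zero w.re) ?_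
    rw [Complex.re_add_im] at h1
    rw [h1, one_mul, Complex.exp_mul_I]
    push_cast [Prod.smul_fst, Prod.smul_snd, smul_eq_mul]
    ring
  have hθc := hθ.1
  have := sub_eq_sub_of_exp_eq_mul (isPreconnected_Icc (a := (0 : ℝ)) (b := 1))
    (φ := fun t => ((Θ (e.symm (γ t))).im * Complex.I : ℂ)) (ψ := fun t => (θ t * Complex.I : ℂ))
    (by fun_prop) (by fun_prop) hangle (by simp : (1 : ℝ) ∈ _) (by simp : (0 : ℝ) ∈ _)
  simp only [hZ _ hγ0, hZ _ hγ1, sub_right_inj] at this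
  exact_mod_cast mul_right_cancel₀ Complex.I_ne_zero this

/-- Vanishing of the index along a curve joining two points
of the same orbit. -/
theorem index_vanishes_same_orbit
    (h : Plane ≃ₜ Plane) (hB : IsBrouwer h) (h1 : h '' Z1 = Z1)
    (hiso : IsotopicRel (⇑h) (⇑T) Z1 ∨ IsotopicRel (⇑h) (⇑T.symm) Z1)
    (γ : ℝ → Plane) (hγ : ContinuousOn γ (Icc 0 1))
    (hγ0 : γ 0 ∈ Z1) (hγ1 : γ 1 ∈ Z1)
    (θ : ℝ → ℝ) (hθ : IsAngleFunction (⇑h) γ θ) :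
    θ 1 = θ 0 := by
  rcases hiso with hiso | hiso
  · exact index_vanishes_of_isotopy_to_translation h hB.2 (Or.inl rfl) (fun x => by simp [T, shear])
      hiso hγ hγ0 hγ1 hθ
  · exact index_vanishes_of_isotopy_to_translation h hB.2 (Or.inr rfl)
      (fun x => by simp [T, shear, sub_eq_add_neg]) hiso hγ hγ0 hγ1 hθ
end
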